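/- Assume the Generalized Riemann Hypothesis for Dirichlet L-functions. Then for every non-principal Dirichlet character χ of modulus d ≤ x one has Σ_{p ≤ x, p prime} χ(p) ≪ x^{1/2}·log x, with an absolute implied constant. -/

import Mathlib

open Filter

/-- The Dirichlet L-function of `χ` (extended by `0` for modulus `0`). -/
noncomputable def LFun (d : ℕ) (χ : DirichletCharacter ℂ d) (s : ℂ) : ℂ :=
  if h : d ≠ 0 then
    letI : NeZero d := ⟨h⟩
    DirichletCharacter.LFunction χ s
  else 0

/-- `𝓛_χ = Σ_p χ(p)/p` has value `L`: the partial sums over primes `p < y`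
converge to `L` as `y → ∞`. -/
def HasCurlyL {d : ℕ} (χ : DirichletCharacter ℂ d) (L : ℝ) : Prop :=
  Filter.Tendsto
    (fun y : ℕ => ∑ p ∈ (Finset.range y).filter Nat.Prime, (χ p).re / (p : ℝ))
    Filter.atTop (nhds L)

/-- Number of ordered pairs `(p, q)` of primes with `p * q ≤ x` satisfying `P p q`. -/
noncomputable def pairCount (x : ℝ) (P : ℕ → ℕ → Prop) : ℕ :=
  Nat.card {pq : ℕ × ℕ // pq.1.Prime ∧ pq.2.Prime ∧ ((pq.1 * pq.2 : ℕ) : ℝ) ≤ x ∧ P pq.1 pq.2}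

/-- The race ratio `#{pq ≤ x : χ(p) = χ(q) = η} / ((1/4) #{pq ≤ x : gcd(pq, d) = 1})`,
where products of two primes are counted as ordered pairs. -/
noncomputable def raceRatio {d : ℕ} (χ : DirichletCharacter ℂ d) (η : ℂ) (x : ℝ) : ℝ :=
  (pairCount x (fun p q => χ p = η ∧ χ q = η) : ℝ) /
    ((1 / 4 : ℝ) * (pairCount x (fun p q => Nat.gcd (p * q) d = 1) : ℝ))

/-- A positive integer is a fundamental discriminant if it is `≡ 1 (mod 4)` and squarefree,
or is `4m` with `m ≡ 2, 3 (mod 4)` squarefree. -/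
def IsFundamentalDiscriminant (d : ℕ) : Prop :=
  0 < d ∧ ((d % 4 = 1 ∧ Squarefree d) ∨
    (d % 4 = 0 ∧ Squarefree (d / 4) ∧ (d / 4 % 4 = 2 ∨ d / 4 % 4 = 3)))

/-- The Generalized Riemann Hypothesis for Dirichlet L-functions: all zeros in the
critical strip lie on the critical line. -/
def GRH : Prop :=
  ∀ (d : ℕ), d ≠ 0 → ∀ (χ : DirichletCharacter ℂ d) (s : ℂ),
    LFun d χ s = 0 → 0 < s.re → s.re < 1 → s.re = 1 / 2

/-- `L(s, χ)` has no real zero `β` with `1 - c / log d ≤ β ≤ 1` (a Siegel zero). -/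
def HasNoSiegelZero (c : ℝ) (d : ℕ) (χ : DirichletCharacter ℂ d) : Prop :=
  ¬ ∃ β : ℝ, 1 - c / Real.log d ≤ β ∧ β ≤ 1 ∧ LFun d χ (β : ℂ) = 0

/-- The logarithmic integral `Li(t) = ∫_2^t du / log u`. -/
noncomputable def Li (t : ℝ) : ℝ := ∫ u in (2:ℝ)..t, 1 / Real.log u

section
open Complex MeasureTheory Set

namespace S17

lemma gamma_ratio {x0 h : ℝ} (hx0 : 0 < x0) (hh : 0 < h) {z : ℂ} (hz : x0 ≤ z.re) :
    ‖Complex.Gamma z‖ * Real.Gamma (x0 + h) ≤ Real.Gamma x0 * ‖Complex.Gamma (z + h)‖ := by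
  have hzr : 0 < z.re := hx0.trans_le hz
  have hhr : 0 < (h : ℂ).re := by simpa using hh
  have hxr : 0 < (x0 : ℂ).re := by simpa using hx0
  have e1 := Complex.Gamma_mul_Gamma_eq_betaIntegral hzr hhr
  have e2 := Complex.Gamma_mul_Gamma_eq_betaIntegral hxr hhr
  have key : ‖betaIntegral z h‖ ≤ ‖betaIntegral x0 h‖ := by
    have c1 := betaIntegral_convergent hzr hhr
    have c2 := betaIntegral_convergent hxr hhr
    calc ‖betaIntegral z h‖ ≤ ∫ u in (0:ℝ)..1, ‖(u:ℂ) ^ (z - 1) * (1 - (u:ℂ)) ^ ((h:ℂ) - 1)‖ :=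
          intervalIntegral.norm_integral_le_integral_norm zero_le_one
      _ ≤ ∫ u in (0:ℝ)..1, ((u:ℂ) ^ ((x0:ℂ) - 1) * (1 - (u:ℂ)) ^ ((h:ℂ) - 1)).re := by
          apply intervalIntegral.integral_mono_on_of_le_Ioo zero_le_one c1.norm
          · exact ⟨c2.1.re, c2.2.re⟩
          · intro u hu
            have h1 : (1 - (u:ℂ)) = ((1 - u : ℝ) : ℂ) := by push_cast; ring
            have h2 : (0:ℝ) < 1 - u := by linarith [hu.2]
            rw [norm_mul, h1, norm_cpow_eq_rpow_re_of_pos hu.1, norm_cpow_eq_rpow_re_of_pos h2,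
              show ((x0:ℂ) - 1) = ((x0 - 1 : ℝ) : ℂ) by push_cast; ring,
              show ((h:ℂ) - 1) = ((h - 1 : ℝ) : ℂ) by push_cast; ring,
              ← ofReal_cpow hu.1.le, ← ofReal_cpow h2.le, ← ofReal_mul, ofReal_re, ofReal_re]
            apply mul_le_mul_of_nonneg_right _ (by positivity)
            apply Real.rpow_le_rpow_of_exponent_ge hu.1 hu.2.le
            simpa using hz
      _ = (betaIntegral x0 h).re := by
          have := intervalIntegral.intervalIntegral_re (𝕜 := ℂ) c2
          simpa [betaIntegral] using this
      _ ≤ ‖betaIntegral x0 h‖ := re_le_norm _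
  have n1 := congrArg norm e1
  have n2 := congrArg norm e2
  rw [norm_mul, norm_mul, Complex.Gamma_ofReal, norm_real, Real.norm_eq_abs,
    abs_of_pos (Real.Gamma_pos_of_pos hh)] at n1
  rw [norm_mul, norm_mul, ← ofReal_add, Complex.Gamma_ofReal, norm_real, Complex.Gamma_ofReal,
    norm_real, Complex.Gamma_ofReal, norm_real, Real.norm_eq_abs, Real.norm_eq_abs,
    Real.norm_eq_abs, abs_of_pos (Real.Gamma_pos_of_pos hh), abs_of_pos (Real.Gamma_pos_of_pos hx0),
    abs_of_pos (Real.Gamma_pos_of_pos (add_pos hx0 hh))] at n2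
  have g := Real.Gamma_pos_of_pos hh
  have g2 := Real.Gamma_pos_of_pos (add_pos hx0 hh)
  refine le_of_mul_le_mul_right ?_ g
  calc _ = (‖Complex.Gamma z‖ * Real.Gamma h) * Real.Gamma (x0 + h) := by ring
    _ = ‖Complex.Gamma (z+h)‖ * ‖betaIntegral z h‖ * Real.Gamma (x0 + h) := by rw [n1]
    _ ≤ ‖Complex.Gamma (z+h)‖ * ‖betaIntegral x0 h‖ * Real.Gamma (x0 + h) := by gcongr
    _ = ‖Complex.Gamma (z+h)‖ * (Real.Gamma (x0 + h) * ‖betaIntegral x0 h‖) := by ring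
    _ = _ := by rw [← n2]; ring

lemma hasDerivAt_log_norm {f : ℂ → ℂ} {z : ℂ} (hf : DifferentiableAt ℂ f z) (h0 : f z ≠ 0) :
    HasDerivAt (fun h : ℝ => Real.log ‖f (z + h)‖) (logDeriv f z).re 0 := by
  have h1 : HasDerivAt (fun h : ℝ => f (z + h)) (deriv f z) 0 := by
    have h2 : HasDerivAt f (deriv f z) (z + ((0:ℝ):ℂ)) := by simpa using hf.hasDerivAt
    have h3 : HasDerivAt (fun h : ℂ => f (z + h)) (deriv f z) ((0:ℝ):ℂ) := by
      simpa using h2.comp_const_add z ((0:ℝ):ℂ)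
    exact h3.comp_ofReal
  have h4 := h1.norm_sq
  have h5 := h4.log (by simpa using h0)
  have h6 := h5.const_mul (1/2 : ℝ)
  refine (h6.congr_deriv ?_).congr_of_eventuallyEq (Filter.Eventually.of_forall fun h => ?_)
  · simp only [ofReal_zero, add_zero]
    rw [Complex.inner, logDeriv_apply, Complex.div_re, ← Complex.normSq_eq_norm_sq]
    simp
    have : normSq (f z) ≠ 0 := by simpa using h0
    field_simp
  · simp only [Real.log_pow]; push_cast; ring

lemma deriv_nonneg_of_right {g : ℝ → ℝ} {g' ε : ℝ} (hg : HasDerivAt g g' 0) (hε : 0 < ε)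
    (h : ∀ η, 0 < η → η < ε → g 0 ≤ g η) : 0 ≤ g' := by
  have := hg.hasDerivWithinAt (s := Ioi 0)
  rw [hasDerivWithinAt_iff_tendsto_slope' (by simp)] at this
  refine ge_of_tendsto this ?_
  filter_upwards [Ioo_mem_nhdsGT hε] with η hη
  rw [slope_def_field]
  apply div_nonneg
  · linarith [h η hη.1 hη.2]
  · linarith [hη.1]

lemma gamma_ne {z : ℂ} (hz : 0 < z.re) : Complex.Gamma z ≠ 0 := Gamma_ne_zero_of_re_pos hz

lemma gamma_diff {z : ℂ} (hz : 0 < z.re) : DifferentiableAt ℂ Complex.Gamma z := by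
  apply differentiableAt_Gamma
  intro m hm
  rw [hm] at hz
  simp at hz
  linarith [(Nat.cast_nonneg m : (0:ℝ) ≤ m)]

lemma digamma_lower : ∃ C : ℝ, 0 < C ∧ ∀ z : ℂ, 1/8 ≤ z.re → -C ≤ (digamma z).re := by
  refine ⟨|(digamma ((1/8:ℝ):ℂ)).re| + 1, by positivity, fun z hz => ?_⟩
  have hz0 : 0 < z.re := by linarith
  have hr0 : 0 < (((1/8:ℝ):ℂ)).re := by rw [ofReal_re]; norm_num
  have d1 := hasDerivAt_log_norm (gamma_diff hz0) (gamma_ne hz0)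
  have d2 := hasDerivAt_log_norm (gamma_diff hr0) (gamma_ne hr0)
  have := deriv_nonneg_of_right (d1.sub d2) (ε := 1) one_pos ?_
  · have h3 := neg_abs_le (digamma ((1/8:ℝ):ℂ)).re
    simp only [digamma_def] at *
    linarith
  · intro η h0 h1
    simp only [Pi.sub_apply, ofReal_zero, add_zero]
    have hr := gamma_ratio (x0 := 1/8) (by norm_num) h0 hz
    have a1 : 0 < ‖Complex.Gamma z‖ := norm_pos_iff.mpr (gamma_ne hz0)
    have a2 : 0 < Real.Gamma (1/8 + η) := Real.Gamma_pos_of_pos (by linarith)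
    have a3 : 0 < Real.Gamma (1/8) := Real.Gamma_pos_of_pos (by norm_num)
    have a4 : 0 < ‖Complex.Gamma (z+η)‖ := norm_pos_iff.mpr (gamma_ne (by simp; linarith))
    have hl := Real.log_le_log (by positivity) hr
    rw [Real.log_mul a1.ne' a2.ne', Real.log_mul a3.ne' a4.ne'] at hl
    rw [← ofReal_add, Complex.Gamma_ofReal, Complex.Gamma_ofReal, norm_real, norm_real,
      Real.norm_eq_abs, Real.norm_eq_abs, abs_of_pos a2, abs_of_pos a3]
    linarith

/-- Harnack-type inequality. -/
lemma harnack {f : ℂ → ℂ} {c z : ℂ} {R : ℝ} (hf : DifferentiableOn ℂ f (Metric.ball c R))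
    (hpos : ∀ w ∈ Metric.ball c R, 0 ≤ (f w).re) (hz : ‖z - c‖ < R) :
    (f z).re ≤ (f c).re * ((R + ‖z - c‖) / (R - ‖z - c‖)) := by
  have hR : 0 < R := (norm_nonneg _).trans_lt hz
  have hmaps : ∀ w ∈ Metric.ball (0:ℂ) R, c + w ∈ Metric.ball c R := by
    intro w hw; simpa using hw
  refine le_of_forall_pos_le_add fun ε hε => ?_
  set q := ‖z - c‖ / (R - ‖z-c‖) with hq
  have hd : 0 < R - ‖z - c‖ := by linarith
  have hq0 : 0 ≤ q := by positivity
  set M := (f c).re + ε / (2 * q + 1) with hM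
  have hfc : 0 ≤ (f c).re := hpos c (Metric.mem_ball_self hR)
  have hMp : 0 < M := by positivity
  have := Complex.borelCaratheodory_zero (f := fun w => f c - f (c + w)) (M := M) (R := R)
    (z := z - c) hMp ?_ ?_ hR (by simpa using hz) (by simp)
  · have h1 : (f z).re - (f c).re ≤ 2 * M * q := by
      have h2 := (abs_re_le_norm (f c - f (c + (z - c)))).trans this
      rw [add_sub_cancel, sub_re] at h2
      have := neg_le_abs ((f c).re - (f z).re)
      rw [hq]; rw [mul_div_assoc'] 
      linarith
    have h3 : (R + ‖z - c‖) / (R - ‖z - c‖) = 1 + 2 * q := by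
      rw [hq]; field_simp; ring
    rw [h3]
    have h4 : 2 * (ε / (2*q+1)) * q ≤ ε := by
      rw [show 2 * (ε / (2*q+1)) * q = ε * (2*q/(2*q+1)) by ring]
      have : 2*q/(2*q+1) ≤ 1 := by rw [div_le_one (by positivity)]; linarith
      nlinarith
    nlinarith
  · apply DifferentiableOn.const_sub
    exact hf.comp (by fun_prop) hmaps
  · intro w hw
    have := hpos _ (hmaps w hw)
    have : 0 ≤ ε / (2*q+1) := by positivity
    simp only [mem_ofPred_eq, sub_re, hM]
    linarith

lemma digamma_diff {z : ℂ} (hz : 0 < z.re) : DifferentiableAt ℂ digamma z := by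
  have hs : IsOpen {w : ℂ | 0 < w.re} := isOpen_lt continuous_const continuous_re
  have hd : DifferentiableOn ℂ Complex.Gamma {w : ℂ | 0 < w.re} :=
    fun w hw => (gamma_diff hw).differentiableWithinAt
  have h2 := (hd.deriv hs).differentiableAt (hs.mem_nhds hz)
  exact h2.div (gamma_diff hz) (gamma_ne hz)

lemma digamma_upper : ∃ C : ℝ, 0 < C ∧ ∀ z : ℂ, 1/4 ≤ z.re →
    (digamma z).re ≤ C * (1 + Real.log (2 + ‖z‖)) := by
  obtain ⟨C, hC, hl⟩ := digamma_lower
  refine ⟨17 * (1 + C), by positivity, fun z hz => ?_⟩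
  -- mean value theorem
  have hder : ∀ u : ℝ, 0 ≤ u →
      HasDerivAt (fun u : ℝ => Real.log ‖Complex.Gamma (z + u)‖) (digamma (z + u)).re u := by
    intro u hu
    have hp : 0 < (z + u).re := by simp; linarith
    have h1 := hasDerivAt_log_norm (gamma_diff hp) (gamma_ne hp)
    have h2 := HasDerivAt.comp_sub_const (x := u) (a := u) (f := fun h : ℝ => Real.log ‖Complex.Gamma (z + u + h)‖)
      (by simpa using h1)
    refine h2.congr_of_eventuallyEq (Filter.Eventually.of_forall fun v => ?_)
    simp
  obtain ⟨u, hu, hmv⟩ := exists_hasDerivAt_eq_slope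
    (fun u : ℝ => Real.log ‖Complex.Gamma (z + u)‖) (fun u => (digamma (z + u)).re)
    (zero_lt_one) (fun u hu => (hder u hu.1).continuousAt.continuousWithinAt)
    (fun u hu => hder u hu.1.le)
  have hz0 : z ≠ 0 := by rintro rfl; norm_num at hz
  have hG : ‖Complex.Gamma z‖ ≠ 0 := norm_ne_zero_iff.mpr (gamma_ne (by linarith))
  have hval : (digamma (z + u)).re = Real.log ‖z‖ := by
    rw [hmv]
    simp only [ofReal_one, ofReal_zero, add_zero]
    rw [Complex.Gamma_add_one z hz0, norm_mul, Real.log_mul (norm_ne_zero_iff.mpr hz0) hG]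
    ring
  have hR : ∀ w ∈ Metric.ball (z + u) (u + 1/8), 1/8 ≤ w.re := by
    intro w hw
    have h1 := abs_re_le_norm (w - (z+u))
    have h2 : ‖w - (z+u)‖ < u + 1/8 := by simpa [dist_eq_norm] using hw
    have h3 := neg_abs_le (w - (z+u)).re
    simp at h3 h1
    linarith
  have hnorm : ‖z - (z + u)‖ = u := by simp [abs_of_pos hu.1]
  have hH := harnack (f := fun w => digamma w + C) (c := z + u) (z := z) (R := u + 1/8)
    (fun w hw => ((digamma_diff (by linarith [hR w hw])).add_const _).differentiableWithinAt)
    (fun w hw => by have := hl w (hR w hw); simp; linarith)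
    (by rw [hnorm]; linarith)
  rw [hnorm] at hH
  simp only [add_re, ofReal_re] at hH
  rw [hval] at hH
  have hlog : Real.log ‖z‖ ≤ Real.log (2 + ‖z‖) :=
    Real.log_le_log (norm_pos_iff.mpr hz0) (by linarith)
  have hlog0 : 0 ≤ Real.log (2 + ‖z‖) := Real.log_nonneg (by linarith [norm_nonneg z])
  have hfac : (u + 1/8 + u) / (u + 1/8 - u) ≤ 17 := by
    rw [div_le_iff₀ (by linarith)]; linarith [hu.2]
  have hfac0 : 0 ≤ (u + 1/8 + u) / (u + 1/8 - u) := div_nonneg (by linarith [hu.1]) (by linarith)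
  have : (Real.log ‖z‖ + C) * ((u + 1/8 + u) / (u + 1/8 - u)) ≤ (Real.log (2 + ‖z‖) + C) * 17 := by
    gcongr
  nlinarith

end S17
end

section
open Complex MeasureTheory Set

namespace S17

lemma sum_range_char_le {N : ℕ} [NeZero N] {χ : DirichletCharacter ℂ N} (hχ : χ ≠ 1) (n : ℕ) :
    ‖∑ k ∈ Finset.range n, χ (k : ZMod N)‖ ≤ N := by
  have hper : Function.Periodic (fun n : ℕ => ∑ k ∈ Finset.range n, χ (k : ZMod N)) N := by
    intro n
    have h0 : ∑ k ∈ Finset.range N, χ (k : ZMod N) = 0 := by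
      rw [← MulChar.sum_eq_zero_of_ne_one hχ, Finset.sum_range]
      refine Fintype.sum_equiv (ZMod.finEquiv N).toEquiv _ _ fun i => ?_
      congr 1
      obtain ⟨m, rfl⟩ : ∃ m, N = m + 1 := ⟨N - 1, by have := NeZero.pos N; omega⟩
      exact Fin.cast_val_eq_self i
    change ∑ k ∈ Finset.range (n + N), χ (k : ZMod N) = _
    rw [add_comm, Finset.sum_range_add, h0, zero_add]
    refine Finset.sum_congr rfl fun k _ => ?_
    simp
  have h1 : ∑ k ∈ Finset.range n, χ (k : ZMod N) = ∑ k ∈ Finset.range (n % N), χ (k : ZMod N) :=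
    (hper.map_mod_nat n).symm
  rw [h1]
  calc _ ≤ ∑ k ∈ Finset.range (n % N), ‖χ (k : ZMod N)‖ := norm_sum_le _ _
    _ ≤ ∑ k ∈ Finset.range (n % N), (1:ℝ) := Finset.sum_le_sum fun k _ => χ.norm_le_one _
    _ ≤ N := by
      simp; exact (Nat.mod_lt n (NeZero.pos N)).le

lemma sum_Icc_char_le {N : ℕ} [NeZero N] {χ : DirichletCharacter ℂ N} (hχ : χ ≠ 1) (n : ℕ) :
    ‖∑ k ∈ Finset.Icc 1 n, χ (k : ZMod N)‖ ≤ N + 1 := by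
  have h : ∑ k ∈ Finset.range (n+1), χ (k : ZMod N) = (∑ k ∈ Finset.Icc 1 n, χ (k : ZMod N)) + χ 0 := by
    induction n with
    | zero => simp
    | succ n ih =>
      rw [Finset.sum_range_succ, ih, Finset.sum_Icc_succ_top (by omega)]
      ring
  rw [eq_sub_of_add_eq h.symm]
  refine (norm_sub_le _ _).trans ?_
  gcongr
  · exact sum_range_char_le hχ _
  · exact χ.norm_le_one _

/-- The function whose Mellin transform gives the continuation. -/
noncomputable def Sfun {N : ℕ} (χ : DirichletCharacter ℂ N) (t : ℝ) : ℂ :=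
  ∑ k ∈ Finset.Icc 1 ⌊t⌋₊, χ (k : ZMod N)

lemma Sfun_loc {N : ℕ} (χ : DirichletCharacter ℂ N) : LocallyIntegrableOn (Sfun χ) (Ioi 0) := by
  have := locallyIntegrableOn_mul_sum_Icc (m := 1) (a := 0) (g := fun _ : ℝ => (1:ℂ))
    (fun k => χ (k : ZMod N)) le_rfl (locallyIntegrableOn_const 1)
  have h2 := this.mono_set Ioi_subset_Ici_self
  simp only [one_mul] at h2
  exact h2

lemma L_upper {N : ℕ} [NeZero N] {χ : DirichletCharacter ℂ N} (hχ : χ ≠ 1) :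
    ∃ C : ℝ, 0 < C ∧ ∀ s : ℂ, 1/4 ≤ s.re → ‖DirichletCharacter.LFunction χ s‖ ≤ C * (1 + ‖s‖) := by
  have hS : ∀ t, ‖Sfun χ t‖ ≤ N + 1 := fun t => sum_Icc_char_le hχ _
  have hS0 : ∀ t < 1, Sfun χ t = 0 := by
    intro t ht
    have : ⌊t⌋₊ = 0 := Nat.floor_eq_zero.mpr ht
    simp [Sfun, this]
  have hdiff : ∀ s : ℂ, 0 < s.re → DifferentiableAt ℂ (mellin (Sfun χ)) (-s) := by
    intro s hs
    refine mellin_differentiableAt_of_isBigO_rpow (a := 0) (b := -s.re - 1) (Sfun_loc χ) ?_ (by simpa using hs) ?_ (by simp)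
    · refine Asymptotics.IsBigO.of_bound (N+1) (Filter.Eventually.of_forall fun t => ?_)
      simpa using hS t
    · refine Asymptotics.IsBigO.of_bound 1 ?_
      filter_upwards [Ioo_mem_nhdsGT (zero_lt_one)] with t ht
      rw [hS0 t ht.2]; simp
  have hmel : ∀ s : ℂ, mellin (Sfun χ) (-s) = ∫ t in Ioi (1:ℝ), (t:ℂ) ^ (-s-1) • Sfun χ t := by
    intro s
    rw [mellin]
    apply setIntegral_eq_of_subset_of_ae_sdiff_eq_zero measurableSet_Ioi.nullMeasurableSet (Ioi_subset_Ioi zero_le_one)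
    have h1 : ∀ᵐ t : ℝ, t ≠ 1 := by simp [ae_iff]
    filter_upwards [h1] with t h1 ht
    rw [hS0 t, smul_zero]
    have := ht.2
    simp at this
    exact lt_of_le_of_ne this h1
  have hopen : IsOpen {s : ℂ | 0 < s.re} := isOpen_lt continuous_const continuous_re
  have heq : EqOn (DirichletCharacter.LFunction χ) (fun s => s * mellin (Sfun χ) (-s)) {s : ℂ | 0 < s.re} := by
    have a1 : AnalyticOnNhd ℂ (DirichletCharacter.LFunction χ) {s : ℂ | 0 < s.re} :=
      (DirichletCharacter.differentiable_LFunction hχ).differentiableOn.analyticOnNhd hopen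
    have a2 : AnalyticOnNhd ℂ (fun s => s * mellin (Sfun χ) (-s)) {s : ℂ | 0 < s.re} := by
      apply DifferentiableOn.analyticOnNhd _ hopen
      intro s hs
      apply DifferentiableAt.differentiableWithinAt
      exact differentiableAt_id.mul ((hdiff s hs).comp s differentiableAt_id.neg)
    refine a1.eqOn_of_preconnected_of_eventuallyEq a2 ?_ (z₀ := 2) (by simp) ?_
    · exact (convex_halfSpace_re_gt 0).isPreconnected
    · have : {s : ℂ | 1 < s.re} ∈ nhds (2:ℂ) :=
        (isOpen_lt continuous_const continuous_re).mem_nhds (by simp)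
      filter_upwards [this] with s hs
      rw [DirichletCharacter.LFunction_eq_LSeries χ hs]
      have hs0 : (0:ℝ) < s.re := lt_trans one_pos hs
      rw [LSeries_eq_mul_integral _ le_rfl hs0 (ZMod.LSeriesSummable_of_one_lt_re χ hs)]
      · congr 1
        rw [hmel]
        refine setIntegral_congr_fun measurableSet_Ioi fun t ht => ?_
        simp only [Sfun, smul_eq_mul]
        rw [mul_comm]
        congr 2; ring
      · refine Asymptotics.IsBigO.of_bound (N+1) (Filter.Eventually.of_forall fun t => ?_)
        simpa using sum_Icc_char_le hχ t
  refine ⟨(N+1) * 4, by positivity, fun s hs => ?_⟩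
  have hs0 : 0 < s.re := by linarith
  rw [heq hs0]
  have hm : ‖mellin (Sfun χ) (-s)‖ ≤ (N+1) * 4 := by
    rw [hmel]
    have hIntegr : IntegrableOn (fun t : ℝ => (N+1) * t ^ (-s.re - 1)) (Ioi 1) :=
      (integrableOn_Ioi_rpow_of_lt (by linarith) one_pos).const_mul _
    refine (norm_integral_le_of_norm_le hIntegr ?_).trans ?_
    · filter_upwards [ae_restrict_mem measurableSet_Ioi] with t ht
      have ht0 : 0 < t := lt_trans one_pos ht
      rw [norm_smul, norm_cpow_eq_rpow_re_of_pos ht0, mul_comm]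
      simp only [sub_re, neg_re, one_re]
      gcongr
      exact hS t
    · rw [integral_const_mul, integral_Ioi_rpow_of_lt (by linarith) one_pos]
      gcongr
      rw [Real.one_rpow, sub_add_cancel, neg_div_neg_eq, div_le_iff₀ hs0]
      linarith
  rw [norm_mul]
  calc ‖s‖ * ‖mellin (Sfun χ) (-s)‖ ≤ (1 + ‖s‖) * ((N+1) * 4) := by gcongr; linarith
    _ = _ := by ring

lemma L_near_one {N : ℕ} [NeZero N] (χ : DirichletCharacter ℂ N) {s : ℂ} (hs : 2 ≤ s.re) :
    ‖DirichletCharacter.LFunction χ s - 1‖ ≤ 7/10 := by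
  rw [DirichletCharacter.LFunction_eq_LSeries χ (by linarith)]
  have hsum := (ZMod.LSeriesSummable_of_one_lt_re (χ : ZMod N → ℂ) (s := s) (by linarith))
  rw [LSeries, ← hsum.sum_add_tsum_nat_add 2]
  have h2 : ∑ i ∈ Finset.range 2, LSeries.term (fun n : ℕ => χ n) s i = 1 := by
    simp [Finset.sum_range_succ, LSeries.term]
  have hz := hasSum_zeta_two
  have hz2 : Summable fun n : ℕ => 1 / ((n + 2 : ℕ) : ℝ)^2 := (summable_nat_add_iff 2).mpr hz.summable
  have hz3 : ∑' n : ℕ, 1 / ((n + 2 : ℕ) : ℝ)^2 = Real.pi^2/6 - 1 := by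
    have := hz.summable.sum_add_tsum_nat_add 2
    rw [hz.tsum_eq] at this
    rw [← this]
    simp [Finset.sum_range_succ]
  rw [h2, add_sub_cancel_left]
  refine (tsum_of_norm_bounded (g := fun n : ℕ => 1 / ((n + 2 : ℕ) : ℝ)^2) hz2.hasSum fun n => ?_).trans ?_
  · rw [LSeries.term_of_ne_zero (by omega), norm_div, norm_natCast_cpow_of_pos (by omega)]
    gcongr
    · exact χ.norm_le_one _
    · rw [← Real.rpow_natCast]
      apply Real.rpow_le_rpow_of_exponent_le
      · push_cast; linarith [(Nat.cast_nonneg n : (0:ℝ) ≤ n)]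
      · simpa using hs
  · rw [hz3]
    have h1 := Real.pi_lt_d2
    have h0 := Real.pi_pos
    nlinarith

end S17
end

section
open Complex MeasureTheory Set

namespace S17

lemma BC_log {f : ℂ → ℂ} {R M δ : ℝ} (hR : 0 < R) (hf : DifferentiableOn ℂ f (Metric.ball 0 R))
    (h0 : ∀ w ∈ Metric.ball (0:ℂ) R, f w ≠ 0) (hM : 0 < M)
    (hbd : ∀ w ∈ Metric.ball (0:ℂ) R, ‖f w‖ ≤ ‖f 0‖ * Real.exp M) (hδ : 0 < δ) {w : ℂ}
    (hw : ‖w‖ ≤ R - δ) :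
    ‖logDeriv f w‖ ≤ 8 * M * R / δ^2 ∧ ‖f 0‖ ≤ ‖f w‖ * Real.exp (2 * M * R / δ) := by
  have hld : DifferentiableOn ℂ (logDeriv f) (Metric.ball 0 R) :=
    (hf.deriv Metric.isOpen_ball).div hf h0
  obtain ⟨g, hg0, hg⟩ := hld.isExactOn_ball.with_val_at 0 0
  have h0mem : (0:ℂ) ∈ Metric.ball (0:ℂ) R := by simpa using hR
  have hgd : DifferentiableOn ℂ g (Metric.ball 0 R) :=
    fun z hz => (hg z hz).differentiableAt.differentiableWithinAt
  have hexp : ∀ z ∈ Metric.ball (0:ℂ) R, f z = f 0 * exp (g z) := by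
    have hderiv : ∀ z ∈ Metric.ball (0:ℂ) R, HasDerivAt (fun z => f z * exp (-g z)) 0 z := by
      intro z hz
      have h1 := ((hf z hz).differentiableAt (Metric.isOpen_ball.mem_nhds hz)).hasDerivAt
      have h2 := h1.mul (hg z hz).neg.cexp
      have e : deriv f z * cexp ((-g) z) + f z * (cexp ((-g) z) * -logDeriv f z) = 0 := by
        rw [logDeriv_apply]
        have := h0 z hz
        field_simp
        ring
      rw [e] at h2
      exact h2
    intro z hz
    have hc := Metric.isOpen_ball.is_const_of_deriv_eq_zero
      (convex_ball (0:ℂ) R).isPreconnected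
      (fun z hz => (hderiv z hz).differentiableAt.differentiableWithinAt)
      (fun z hz => (hderiv z hz).deriv) hz h0mem
    simp only [hg0, neg_zero, exp_zero, mul_one] at hc
    rw [← hc, mul_assoc, ← exp_add]; simp
  have hf0 : 0 < ‖f 0‖ := norm_pos_iff.mpr (h0 0 h0mem)
  have hre : MapsTo g (Metric.ball 0 R) {z | z.re ≤ M} := by
    intro z hz
    have h1 := hbd z hz
    rw [hexp z hz, norm_mul, norm_exp] at h1
    exact Real.exp_le_exp.mp (le_of_mul_le_mul_left h1 hf0)
  have hbc : ∀ ε > 0, ∀ z : ℂ, ‖z‖ ≤ R - ε → ‖g z‖ ≤ 2 * M * R / ε := by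
    intro ε hε z hz
    refine (borelCaratheodory_zero hM hgd hre hR (by rw [mem_ball_zero_iff]; linarith) hg0).trans ?_
    have : ‖z‖ ≤ R := by linarith
    gcongr
    linarith
  have hwm : w ∈ Metric.ball (0:ℂ) R := by rw [mem_ball_zero_iff]; linarith
  constructor
  · rw [← (hg w hwm).deriv]
    have hsub : Metric.closedBall w (δ/2) ⊆ Metric.ball 0 R := by
      intro z hz
      rw [Metric.mem_closedBall, dist_eq_norm] at hz
      rw [mem_ball_zero_iff]
      have := norm_add_le (z - w) w
      rw [sub_add_cancel] at this
      linarith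
    have := norm_deriv_le_of_forall_mem_sphere_norm_le (c := w) (R := δ/2) (f := g) (C := 2 * M * R / (δ/2))
      (by positivity) (DifferentiableOn.diffContOnCl (by
        rw [closure_ball _ (by positivity)]; exact hgd.mono hsub)) (fun z hz => hbc _ (by positivity) z (by
          rw [mem_sphere_iff_norm] at hz
          have := norm_add_le (z - w) w
          rw [sub_add_cancel] at this
          linarith))
    refine this.trans (le_of_eq ?_)
    field_simp
    norm_num
  · rw [hexp w hwm, norm_mul, norm_exp, mul_assoc, ← Real.exp_add]
    refine le_mul_of_one_le_right hf0.le (Real.one_le_exp ?_)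
    have h1 := hbc δ hδ w hw
    have h2 := neg_abs_le (g w).re
    have h3 := abs_re_le_norm (g w)
    linarith

lemma L_growth {N : ℕ} [NeZero N] {χ : DirichletCharacter ℂ N} (hχ : χ ≠ 1)
    (hnz : ∀ s : ℂ, 1/2 < s.re → DirichletCharacter.LFunction χ s ≠ 0) {δ : ℝ} (hδ : 0 < δ) :
    ∃ C : ℝ, 0 < C ∧ ∀ s : ℂ, 1/2 + δ ≤ s.re → s.re ≤ 2 →
      ‖logDeriv (DirichletCharacter.LFunction χ) s‖ ≤ C * √(1 + |s.im|) ∧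
      ‖DirichletCharacter.LFunction χ s‖⁻¹ ≤ Real.exp (C * √(1 + |s.im|)) := by
  obtain ⟨C₀, hC₀, hL⟩ := L_upper hχ
  set A := 2 * √(20 * C₀) with hA
  have hA0 : 0 < A := by positivity
  refine ⟨8 * A * (3/2) / δ^2 + 2 * A * (3/2) / δ + 10/3, by positivity, fun s hs1 hs2 => ?_⟩
  set t := s.im
  set c : ℂ := 2 + t * I with hc
  set Q := √(1 + |t|) with hQ
  have hQ1 : 1 ≤ Q := Real.one_le_sqrt.mpr (by linarith [abs_nonneg t])
  have hcre : c.re = 2 := by simp [c]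
  have hcn : ‖c‖ ≤ 2 + |t| := by
    refine (norm_add_le _ _).trans ?_
    simp
  have hLc : 3/10 ≤ ‖DirichletCharacter.LFunction χ c‖ := by
    have h1 := L_near_one χ (s := c) hcre.ge
    have h2 := norm_sub_norm_le (1:ℂ) (1 - DirichletCharacter.LFunction χ c)
    rw [← norm_neg, neg_sub] at h1
    simp only [sub_sub_cancel, norm_one] at h2
    linarith
  have hw : ‖s - c‖ ≤ 3/2 - δ := by
    have : s - c = ((s.re - 2 : ℝ) : ℂ) := by
      apply Complex.ext <;> simp [c, t]
    rw [this, norm_real, Real.norm_eq_abs, abs_le]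
    constructor <;> linarith
  have key := BC_log (f := fun w => DirichletCharacter.LFunction χ (c + w)) (R := 3/2) (M := A * Q) (δ := δ)
    (by norm_num) ?_ ?_ (by positivity) ?_ hδ hw
  · simp only [add_sub_cancel, add_zero] at key
    have e : logDeriv (fun w => DirichletCharacter.LFunction χ (c + w)) (s - c) = logDeriv (DirichletCharacter.LFunction χ) s := by
      rw [logDeriv_apply, logDeriv_apply, deriv_comp_const_add, add_sub_cancel]
    rw [e] at key
    obtain ⟨k1, k2⟩ := key
    constructor
    · refine k1.trans ?_
      have : 8 * (A * Q) * (3/2) / δ^2 = 8 * A * (3/2) / δ^2 * Q := by ring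
      rw [this]
      gcongr
      have h1 : 0 ≤ 2 * A * (3/2) / δ := by positivity
      linarith
    · have hLs : 0 < ‖DirichletCharacter.LFunction χ s‖ := norm_pos_iff.mpr (hnz s (by linarith))
      rw [inv_le_iff_one_le_mul₀ hLs]
      have h4 : (10:ℝ)/3 ≤ Real.exp (10/3 * Q) := by
        have := Real.add_one_le_exp (10/3 * Q)
        linarith
      have h5 : Real.exp (2 * (A * Q) * (3/2) / δ) * Real.exp (10/3 * Q) ≤
          Real.exp ((8 * A * (3/2) / δ^2 + 2 * A * (3/2) / δ + 10/3) * Q) := by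
        rw [← Real.exp_add, Real.exp_le_exp]
        have h6 : 0 ≤ 8 * A * (3/2) / δ^2 * Q := by positivity
        have : (8 * A * (3/2) / δ^2 + 2 * A * (3/2) / δ + 10/3) * Q
          = 8 * A * (3/2) / δ^2 * Q + (2 * (A * Q) * (3/2) / δ + 10/3 * Q) := by ring
        linarith
      have h7 : 3/10 ≤ Real.exp (2 * (A * Q) * (3/2) / δ) * ‖DirichletCharacter.LFunction χ s‖ := by linarith
      calc (1:ℝ) = 3/10 * (10/3) := by norm_num
        _ ≤ (Real.exp (2 * (A * Q) * (3/2) / δ) * ‖DirichletCharacter.LFunction χ s‖) * Real.exp (10/3 * Q) := by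
          gcongr
        _ = (Real.exp (2 * (A * Q) * (3/2) / δ) * Real.exp (10/3 * Q)) * ‖DirichletCharacter.LFunction χ s‖ := by ring
        _ ≤ _ := by gcongr
  · exact ((DirichletCharacter.differentiable_LFunction hχ).comp (differentiable_id.const_add c)).differentiableOn
  · intro w hw
    rw [mem_ball_zero_iff] at hw
    apply hnz
    have := (abs_le.mp ((abs_re_le_norm w))).1
    rw [add_re, hcre]; linarith
  · intro w hw
    rw [mem_ball_zero_iff] at hw
    simp only [add_zero]
    have h1 := (abs_le.mp ((abs_re_le_norm w))).1
    have h2 := hL (c + w) (by rw [add_re, hcre]; linarith)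
    have h3 : ‖c + w‖ ≤ 4 + |t| := by
      refine (norm_add_le _ _).trans ?_
      linarith
    have h4 : 20 * C₀ * (1 + |t|) ≤ Real.exp (A * Q) := by
      have e1 : 20 * C₀ * (1 + |t|) = (A * Q / 2)^2 := by
        rw [hA, hQ]
        have : (2 * √(20 * C₀) * √(1 + |t|) / 2)^2 = (√(20*C₀))^2 * (√(1+|t|))^2 := by ring
        rw [this, Real.sq_sqrt (by positivity), Real.sq_sqrt (by positivity)]
      have e2 : A * Q / 2 ≤ Real.exp (A * Q / 2) := by
        have := Real.add_one_le_exp (A * Q / 2); linarith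
      calc _ = (A * Q / 2)^2 := e1
        _ ≤ (Real.exp (A * Q / 2))^2 := by gcongr
        _ = _ := by rw [← Real.exp_nat_mul]; congr 1; push_cast; ring
    calc ‖DirichletCharacter.LFunction χ (c + w)‖ ≤ C₀ * (1 + (4 + |t|)) := h2.trans (by gcongr)
      _ ≤ 3/10 * (20 * C₀ * (1 + |t|)) := by nlinarith [abs_nonneg t, mul_nonneg hC₀.le (abs_nonneg t)]
      _ ≤ _ := by gcongr

end S17
end

section
open Complex MeasureTheory Set

namespace S17

open scoped ComplexConjugate in
lemma Gammaℝ_conj (s : ℂ) : Gammaℝ (conj s) = conj (Gammaℝ s) := by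
  rw [Gammaℝ_def, Gammaℝ_def, map_mul, ← Gamma_conj]
  have hπ : (Real.pi : ℂ).arg ≠ Real.pi := by
    rw [arg_ofReal_of_nonneg Real.pi_pos.le]; exact Real.pi_pos.ne
  congr 1
  · have : -conj s / 2 = conj (-s/2) := by simp [conj_ofNat]
    rw [this, cpow_conj _ _ hπ, conj_ofReal]
  · simp [conj_ofNat]

open scoped Classical in
/-- parity -/
noncomputable def par {N : ℕ} (χ : DirichletCharacter ℂ N) : ℝ := if χ.Even then 0 else 1

lemma par_nonneg {N : ℕ} (χ : DirichletCharacter ℂ N) : 0 ≤ par χ := by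
  unfold par; split_ifs <;> norm_num

lemma par_le {N : ℕ} (χ : DirichletCharacter ℂ N) : par χ ≤ 1 := by
  unfold par; split_ifs <;> norm_num

lemma gammaFactor_eq {N : ℕ} (χ : DirichletCharacter ℂ N) (s : ℂ) :
    χ.gammaFactor s = Gammaℝ (s + par χ) := by
  unfold par DirichletCharacter.gammaFactor; split_ifs <;> simp

lemma par_inv {N : ℕ} (χ : DirichletCharacter ℂ N) : par χ⁻¹ = par χ := by
  have : χ⁻¹.Even = χ.Even := by
    apply propext
    unfold DirichletCharacter.Even
    rw [← MulChar.star_apply']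
    constructor
    · intro h; have := congrArg star h; simpa using this
    · intro h; rw [h]; simp
  unfold par
  by_cases h : χ.Even
  · rw [if_pos h, if_pos (this ▸ h)]
  · rw [if_neg h, if_neg (this ▸ h)]

lemma completed_eq {N : ℕ} [NeZero N] (χ : DirichletCharacter ℂ N) {s : ℂ} (hs : 0 < s.re) :
    χ.completedLFunction s = Gammaℝ (s + par χ) * χ.LFunction s := by
  have h1 := χ.LFunction_eq_completed_div_gammaFactor s (Or.inl (by rintro rfl; simp at hs))
  rw [h1, gammaFactor_eq, mul_div_cancel₀]
  apply Gammaℝ_ne_zero_of_re_pos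
  simp only [add_re, ofReal_re]
  linarith [par_nonneg χ]

open scoped ComplexConjugate in
lemma completed_conj {N : ℕ} [NeZero N] {χ : DirichletCharacter ℂ N} (hχ : χ ≠ 1) (s : ℂ) :
    χ⁻¹.completedLFunction s = conj (χ.completedLFunction (conj s)) := by
  have hχ' : χ⁻¹ ≠ 1 := by simpa using hχ
  have a1 : AnalyticOnNhd ℂ (χ⁻¹.completedLFunction) univ :=
    (DirichletCharacter.differentiable_completedLFunction hχ').differentiableOn.analyticOnNhd isOpen_univ
  have a2 : AnalyticOnNhd ℂ (fun s => conj (χ.completedLFunction (conj s))) univ := by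
    apply DifferentiableOn.analyticOnNhd _ isOpen_univ
    intro s _
    apply DifferentiableAt.differentiableWithinAt
    have := (DirichletCharacter.differentiable_completedLFunction hχ (conj s)).star_star
    simpa [Function.comp_def] using! this
  refine a1.eqOn_of_preconnected_of_eventuallyEq a2 isPreconnected_univ (z₀ := 2) (by simp) ?_ (mem_univ s)
  have : {s : ℂ | 1 < s.re} ∈ nhds (2:ℂ) :=
    (isOpen_lt continuous_const continuous_re).mem_nhds (by simp)
  filter_upwards [this] with s hs
  have hs1 : 1 < s.re := hs
  rw [completed_eq _ (by linarith), completed_eq _ (by rw [conj_re]; linarith), par_inv, map_mul, ← Gammaℝ_conj]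
  congr 1
  · simp
  · rw [DirichletCharacter.LFunction_eq_LSeries _ hs1, DirichletCharacter.LFunction_eq_LSeries _ (by rwa [conj_re]),
      LSeries, LSeries, conj_tsum]
    congr 1
    ext n
    rcases eq_or_ne n 0 with rfl | hn
    · simp
    · rw [LSeries.term_of_ne_zero hn, LSeries.term_of_ne_zero hn, map_div₀, ← MulChar.star_apply']
      congr 1
      rw [cpow_conj]
      · simp
      · rw [natCast_arg]; exact Real.pi_pos.ne

lemma norm_FE {N : ℕ} [NeZero N] {χ : DirichletCharacter ℂ N} (hχ : χ ≠ 1) (hp : χ.IsPrimitive) (η t : ℝ) :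
    ‖χ.completedLFunction (1/2 + t * I - η)‖ =
      (N:ℝ)^η * ‖χ.rootNumber‖ * ‖χ.completedLFunction (1/2 + t * I + η)‖ := by
  have h1 := hp.completedLFunction_one_sub (1/2 - t * I + η)
  have e : 1 - (1/2 - t * I + η) = 1/2 + t * I - (η:ℂ) := by ring
  rw [e, completed_conj hχ] at h1
  rw [h1, norm_mul, norm_mul, RCLike.norm_conj]
  congr 1
  · congr 1
    rw [norm_natCast_cpow_of_pos (NeZero.pos N)]
    simp
  · congr 2
    apply Complex.ext <;> simp

lemma norm_root {N : ℕ} [NeZero N] {χ : DirichletCharacter ℂ N} (hχ : χ ≠ 1) (hp : χ.IsPrimitive) :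
    ‖χ.rootNumber‖ = 1 := by
  have h1 := norm_FE hχ hp (3/2) 0
  have h2 := norm_FE hχ hp (-(3/2)) 0
  have hN : (0:ℝ) < N := by exact_mod_cast NeZero.pos N
  have e1 : (1/2 + ((0:ℝ):ℂ) * I + ((3/2:ℝ):ℂ)) = 2 := by push_cast; ring
  have e2 : (1/2 + ((0:ℝ):ℂ) * I - ((-(3/2):ℝ):ℂ)) = 2 := by push_cast; ring
  have e3 : (1/2 + ((0:ℝ):ℂ) * I + ((-(3/2):ℝ):ℂ)) = 1/2 + ((0:ℝ):ℂ) * I - ((3/2:ℝ):ℂ) := by push_cast; ring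
  rw [e1] at h1
  rw [e2, e3, h1] at h2
  have h3 : ‖χ.completedLFunction 2‖ ≠ 0 := by
    rw [completed_eq _ (by simp), norm_ne_zero_iff]
    refine mul_ne_zero (Gammaℝ_ne_zero_of_re_pos ?_) (DirichletCharacter.LFunction_ne_zero_of_one_le_re χ (Or.inl hχ) (by simp))
    simp; linarith [par_nonneg χ]
  rw [Real.rpow_neg hN.le] at h2
  have h4 : (N:ℝ) ^ (3/2:ℝ) ≠ 0 := by positivity
  have h5 : ‖χ.completedLFunction 2‖ = ‖χ.rootNumber‖^2 * ‖χ.completedLFunction 2‖ := by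
    refine h2.trans ?_
    field_simp
  have h6 : ‖χ.rootNumber‖^2 = 1 := by
    field_simp at h5
    exact h5.symm
  nlinarith [norm_nonneg χ.rootNumber]

end S17
end

section
open Complex MeasureTheory Set

namespace S17

lemma Gammaℝ_ratio {η : ℝ} (hη : 0 < η) : ∃ K : ℝ, 0 < K ∧ ∀ z : ℂ, 3/8 ≤ z.re →
    ‖Gammaℝ z‖ ≤ K * ‖Gammaℝ (z + 2 * η)‖ := by
  have hg1 : 0 < Real.Gamma (3/16) := Real.Gamma_pos_of_pos (by norm_num)
  have hg2 : 0 < Real.Gamma (3/16 + η) := Real.Gamma_pos_of_pos (by linarith)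
  refine ⟨Real.pi ^ η * (Real.Gamma (3/16) / Real.Gamma (3/16 + η)), by positivity, fun z hz => ?_⟩
  have h1 := gamma_ratio (x0 := 3/16) (h := η) (by norm_num) hη (z := z/2) (by
    rw [div_ofNat_re]; linarith)
  rw [Gammaℝ_def, Gammaℝ_def, norm_mul, norm_mul, norm_cpow_eq_rpow_re_of_pos Real.pi_pos,
    norm_cpow_eq_rpow_re_of_pos Real.pi_pos]
  have e1 : (z + 2 * η)/2 = z/2 + η := by ring
  have e2 : (-(z + 2 * η)/2).re = (-z/2).re - η := by
    have : -(z + 2 * η)/2 = -z/2 - η := by ring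
    rw [this, sub_re, ofReal_re]
  rw [e1, e2, Real.rpow_sub Real.pi_pos]
  have h2 : ‖Gamma (z/2)‖ ≤ Real.Gamma (3/16) / Real.Gamma (3/16 + η) * ‖Gamma (z/2 + η)‖ := by
    rw [div_mul_eq_mul_div, le_div_iff₀ hg2]; exact h1
  have hπ : (0:ℝ) < Real.pi ^ η := by positivity
  calc _ ≤ Real.pi ^ (-z/2).re * (Real.Gamma (3/16) / Real.Gamma (3/16 + η) * ‖Gamma (z/2 + η)‖) := by gcongr
    _ = _ := by field_simp

lemma L_lower2 {N : ℕ} [NeZero N] (χ : DirichletCharacter ℂ N) {s : ℂ} (hs : 2 ≤ s.re) :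
    ‖χ.LFunction s‖⁻¹ ≤ 10/3 ∧ ‖χ.LFunction s‖ ≤ 17/10 := by
  have h1 := L_near_one χ hs
  have h2 := norm_sub_norm_le (1:ℂ) (1 - χ.LFunction s)
  have h3 := norm_sub_norm_le (χ.LFunction s) 1
  rw [← norm_neg, neg_sub] at h1
  simp only [sub_sub_cancel, norm_one] at h2 h3
  rw [norm_sub_rev] at h3
  constructor
  · rw [inv_le_comm₀ (by linarith) (by norm_num)]; norm_num; linarith
  · linarith

lemma xi_mono {N : ℕ} [NeZero N] {χ : DirichletCharacter ℂ N} (hχ : χ ≠ 1) (hp : χ.IsPrimitive)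
    (hnz : ∀ s : ℂ, 1/2 < s.re → χ.LFunction s ≠ 0) {η : ℝ} (hη : 0 < η) (hη' : η < 1/8) {s : ℂ}
    (hs : 1/2 ≤ s.re) :
    ‖χ.completedLFunction (s - η)‖ ≤ (N:ℝ)^η * ‖χ.completedLFunction (s + η)‖ := by
  have hN : (0:ℝ) < N := by exact_mod_cast NeZero.pos N
  have hNη : (0:ℝ) < (N:ℝ)^η := by positivity
  have hΛ : ∀ z : ℂ, 1/2 < z.re → χ.completedLFunction z ≠ 0 := by
    intro z hz
    rw [completed_eq _ (by linarith)]
    refine mul_ne_zero (Gammaℝ_ne_zero_of_re_pos ?_) (hnz z hz)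
    simp; linarith [par_nonneg χ]
  set Q : ℂ → ℂ := fun w => χ.completedLFunction (1/2 + w - η) / χ.completedLFunction (1/2 + w + η) with hQ
  have hre1 : ∀ w : ℂ, (1/2 + w - η).re = 1/2 + w.re - η := by intro w; simp
  have hre2 : ∀ w : ℂ, (1/2 + w + η).re = 1/2 + w.re + η := by intro w; simp
  obtain ⟨K, hK, hKb⟩ := Gammaℝ_ratio hη
  have hQ1 : ∀ w : ℂ, 0 ≤ w.re → ‖Q w‖ ≤ K * ‖χ.LFunction (1/2 + w - η)‖ * ‖χ.LFunction (1/2 + w + η)‖⁻¹ := by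
    intro w hw
    simp only [Q]
    rw [completed_eq _ (by rw [hre1]; linarith), completed_eq _ (by rw [hre2]; linarith), norm_div, norm_mul, norm_mul]
    have h1 := hKb (1/2 + w - η + par χ) (by rw [add_re, hre1, ofReal_re]; linarith [par_nonneg χ])
    have e : 1/2 + w - η + par χ + 2 * η = 1/2 + w + η + par χ := by ring
    rw [e] at h1
    have hL : 0 < ‖χ.LFunction (1/2 + w + η)‖ := norm_pos_iff.mpr (hnz _ (by rw [hre2]; linarith))
    have hG : 0 < ‖Gammaℝ (1/2 + w + η + par χ)‖ := norm_pos_iff.mpr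
      (Gammaℝ_ne_zero_of_re_pos (by rw [add_re, hre2, ofReal_re]; linarith [par_nonneg χ]))
    rw [div_le_iff₀ (by positivity)]
    calc _ ≤ (K * ‖Gammaℝ (1/2 + w + η + par χ)‖) * ‖χ.LFunction (1/2 + w - η)‖ := by gcongr
      _ = _ := by
        generalize ‖χ.LFunction (1/2 + w + η)‖ = A at *
        have := hL.ne'
        rw [mul_assoc _ A⁻¹, mul_comm _ A, inv_mul_cancel_left₀ this]
        ring
  have key : ∀ w : ℂ, 0 ≤ w.re → ‖Q w‖ ≤ (N:ℝ)^η := by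
    intro w hw
    refine PhragmenLindelof.right_half_plane_of_bounded_on_real (f := Q) ?_ ?_ ?_ ?_ hw
    · apply DifferentiableOn.diffContOnCl
      rw [closure_setOfPred_lt_re]
      intro z hz
      have hz' : 0 ≤ z.re := hz
      apply DifferentiableAt.differentiableWithinAt
      have hd := DirichletCharacter.differentiable_completedLFunction hχ
      refine DifferentiableAt.div ?_ ?_ (hΛ _ (by rw [hre2]; linarith))
      · exact (hd _).comp z ((differentiableAt_id.const_add _).sub_const _)
      · exact (hd _).comp z ((differentiableAt_id.const_add _).add_const _)
    · obtain ⟨C₀, hC₀, hL⟩ := L_upper hχ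
      obtain ⟨C₁, hC₁, hL'⟩ := L_growth hχ hnz hη
      refine ⟨1, by norm_num, 2 + 2 * C₁, ?_⟩
      refine Asymptotics.IsBigO.of_bound (K * C₀ * (10/3)) ?_
      have hc : ∀ᶠ z in Bornology.cobounded ℂ, 1 ≤ ‖z‖ :=
        (tendsto_norm_cobounded_atTop).eventually (Filter.eventually_ge_atTop 1)
      have h2 : ∀ᶠ z in Filter.principal {z : ℂ | 0 < z.re}, 0 < z.re := Filter.eventually_principal.mpr fun _ h => h
      filter_upwards [hc.filter_mono inf_le_left, h2.filter_mono inf_le_right] with z hz1 hz0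
      have hz0 : 0 < z.re := hz0
      refine (hQ1 z hz0.le).trans ?_
      rw [Real.norm_eq_abs, abs_of_pos (Real.exp_pos _), Real.rpow_one]
      have b1 : ‖χ.LFunction (1/2 + z - η)‖ ≤ C₀ * Real.exp (2 * ‖z‖) := by
        refine (hL _ (by rw [hre1]; linarith)).trans ?_
        gcongr
        have n1 : ‖(1/2 + z - η)‖ ≤ 1/2 + ‖z‖ + η := by
          refine (norm_sub_le _ _).trans ?_
          gcongr
          · refine (norm_add_le _ _).trans ?_
            simp
          · rw [norm_real, Real.norm_eq_abs, abs_of_pos hη]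
        have := Real.add_one_le_exp (2 * ‖z‖)
        linarith
      have b2 : ‖χ.LFunction (1/2 + z + η)‖⁻¹ ≤ 10/3 * Real.exp (2 * C₁ * ‖z‖) := by
        rcases le_total (1/2 + z + η).re 2 with h | h
        · refine (hL' _ (by rw [hre2]; linarith) h).2.trans ?_
          have : (1/2 + z + η).im = z.im := by simp
          rw [this]
          have h3 : √(1 + |z.im|) ≤ 2 * ‖z‖ := by
            have h4 := abs_im_le_norm z
            have h5 : √(1 + |z.im|) ≤ 1 + |z.im| := by
              rw [Real.sqrt_le_left (by positivity)]
              nlinarith [abs_nonneg z.im]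
            linarith
          have h6 : Real.exp (C₁ * √(1 + |z.im|)) ≤ Real.exp (2 * C₁ * ‖z‖) := by
            rw [Real.exp_le_exp]; nlinarith
          linarith [Real.exp_pos (2 * C₁ * ‖z‖)]
        · refine (L_lower2 χ h).1.trans ?_
          have : 1 ≤ Real.exp (2 * C₁ * ‖z‖) := Real.one_le_exp (by positivity)
          linarith
      calc _ ≤ K * (C₀ * Real.exp (2 * ‖z‖)) * (10/3 * Real.exp (2 * C₁ * ‖z‖)) := by gcongr
        _ = K * C₀ * (10/3) * (Real.exp (2 * ‖z‖) * Real.exp (2 * C₁ * ‖z‖)) := by ring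
        _ = _ := by rw [← Real.exp_add]; ring_nf
    · refine Filter.isBoundedUnder_of_eventually_le (a := K * (17/10) * (10/3)) ?_
      filter_upwards [Filter.eventually_ge_atTop 2] with x hx
      refine (hQ1 x (by rw [ofReal_re]; linarith)).trans ?_
      gcongr
      · exact (L_lower2 χ (by rw [hre1, ofReal_re]; linarith)).2
      · exact (L_lower2 χ (by rw [hre2, ofReal_re]; linarith)).1
    · intro x
      have := norm_FE hχ hp η x
      rw [norm_root hχ hp, mul_one] at this
      simp only [Q]
      rw [norm_div, this, mul_div_assoc, div_self, mul_one]
      rw [norm_ne_zero_iff]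
      apply hΛ
      rw [hre2]; simp [hη]
  have := key (s - 1/2) (by simp; linarith)
  simp only [Q] at this
  rw [add_sub_cancel, norm_div, div_le_iff₀] at this
  · exact this
  · rw [norm_pos_iff]; apply hΛ; simp; linarith

lemma pos_main {N : ℕ} [NeZero N] {χ : DirichletCharacter ℂ N} (hχ : χ ≠ 1) (hp : χ.IsPrimitive)
    (hnz : ∀ s : ℂ, 1/2 < s.re → χ.LFunction s ≠ 0) {s : ℂ} (hs : 1/2 < s.re) :
    0 ≤ (logDeriv χ.LFunction s).re + 1/2 * Real.log N - 1/2 * Real.log Real.pi +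
      1/2 * (digamma ((s + par χ)/2)).re := by
  have hN : (0:ℝ) < N := by exact_mod_cast NeZero.pos N
  have hpar := par_nonneg χ
  have hΛ : ∀ z : ℂ, 1/2 < z.re → χ.completedLFunction z ≠ 0 := by
    intro z hz
    rw [completed_eq _ (by linarith)]
    refine mul_ne_zero (Gammaℝ_ne_zero_of_re_pos ?_) (hnz z hz)
    simp; linarith [par_nonneg χ]
  have hd := DirichletCharacter.differentiable_completedLFunction hχ
  have d1 := hasDerivAt_log_norm (hd s) (hΛ s hs)
  have d2 : HasDerivAt (fun h : ℝ => Real.log ‖χ.completedLFunction (s - h)‖) (-(logDeriv χ.completedLFunction s).re) 0 := by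
    have h1 : HasDerivAt (fun h : ℝ => -h) (-1) 0 := (hasDerivAt_id (0:ℝ)).neg
    have d1' : HasDerivAt (fun h : ℝ => Real.log ‖χ.completedLFunction (s + h)‖) (logDeriv χ.completedLFunction s).re (-0) := by
      rwa [neg_zero]
    have := d1'.comp (0:ℝ) h1
    rw [mul_neg_one] at this
    simpa [Function.comp_def, sub_eq_add_neg] using! this
  have d3 : HasDerivAt (fun h : ℝ => h * Real.log N) (Real.log N) 0 := by
    simpa using (hasDerivAt_id (0:ℝ)).mul_const (Real.log N)
  have d := (d1.sub d2).add d3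
  have h0 : 0 ≤ (logDeriv χ.completedLFunction s).re - -(logDeriv χ.completedLFunction s).re + Real.log N := by
    refine deriv_nonneg_of_right d (ε := min (1/8) (s.re - 1/2)) (lt_min (by norm_num) (by linarith)) ?_
    intro η hη hη'
    have hm := xi_mono hχ hp hnz hη (hη'.trans_le (min_le_left _ _)) hs.le
    have hη2 := hη'.trans_le (min_le_right _ _)
    have p1 : 0 < ‖χ.completedLFunction (s - η)‖ := norm_pos_iff.mpr (hΛ _ (by simp; linarith))
    have p2 : 0 < ‖χ.completedLFunction (s + η)‖ := norm_pos_iff.mpr (hΛ _ (by simp; linarith))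
    have := Real.log_le_log p1 hm
    rw [Real.log_mul (by positivity) p2.ne', Real.log_rpow hN] at this
    simp
    linarith
  have hlog : logDeriv χ.completedLFunction s = logDeriv χ.LFunction s - 1/2 * Real.log Real.pi + 1/2 * digamma ((s + par χ)/2) := by
    have e1 : χ.completedLFunction =ᶠ[nhds s] fun z => ((Real.pi:ℂ)^(-(z + par χ)/2) * Gamma ((z + par χ)/2)) * χ.LFunction z := by
      have : {s : ℂ | 0 < s.re} ∈ nhds s :=
        (isOpen_lt continuous_const continuous_re).mem_nhds (by show 0 < s.re; linarith)
      filter_upwards [this] with z hz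
      rw [completed_eq χ hz, Gammaℝ_def]
    have hz2 : 0 < ((s + par χ)/2).re := by
      rw [div_ofNat_re, add_re, ofReal_re]; linarith
    have hG : DifferentiableAt ℂ (fun z : ℂ => Gamma ((z + par χ)/2)) s :=
      (gamma_diff hz2).comp s (f := fun z : ℂ => (z + par χ)/2) ((differentiableAt_id.add_const _).div_const _)
    have hG' : HasDerivAt (fun z : ℂ => Gamma ((z + par χ)/2)) (deriv Gamma ((s + par χ)/2) * (1/2)) s := by
      have h1 : HasDerivAt (fun z : ℂ => (z + par χ)/2) (1/2) s := ((hasDerivAt_id s).add_const _).div_const _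
      exact (gamma_diff hz2).hasDerivAt.comp s h1
    have hπ0 : (Real.pi : ℂ) ≠ 0 := by exact_mod_cast Real.pi_ne_zero
    have hP' : HasDerivAt (fun z : ℂ => (Real.pi:ℂ)^(-(z + par χ)/2)) ((Real.pi:ℂ)^(-(s + par χ)/2) * Complex.log Real.pi * (-1/2)) s := by
      have h1 : HasDerivAt (fun z : ℂ => -(z + par χ)/2) (-1/2) s := ((hasDerivAt_id s).add_const _).neg.div_const _
      exact h1.const_cpow (Or.inl hπ0)
    have hPne : (Real.pi:ℂ)^(-(s + par χ)/2) ≠ 0 := by simp [cpow_eq_zero_iff, hπ0]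
    have hGne := gamma_ne hz2
    have e2 : logDeriv χ.completedLFunction s = logDeriv (fun z : ℂ => ((Real.pi:ℂ)^(-(z + par χ)/2) * Gamma ((z + par χ)/2)) * χ.LFunction z) s := by
      rw [logDeriv_apply, logDeriv_apply, e1.deriv_eq, e1.eq_of_nhds]
    rw [e2, logDeriv_mul (f := fun z : ℂ => (Real.pi:ℂ)^(-(z + par χ)/2) * Gamma ((z + par χ)/2)) (g := χ.LFunction) _ (mul_ne_zero hPne hGne) (hnz s hs) (hP'.differentiableAt.mul hG)
      (DirichletCharacter.differentiable_LFunction hχ s), logDeriv_mul (f := fun z : ℂ => (Real.pi:ℂ)^(-(z + par χ)/2)) (g := fun z : ℂ => Gamma ((z + par χ)/2)) _ hPne hGne hP'.differentiableAt hG]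
    rw [logDeriv_apply (fun z : ℂ => (Real.pi:ℂ)^(-(z + par χ)/2)), logDeriv_apply (fun z : ℂ => Gamma ((z + par χ)/2)), hP'.deriv, hG'.deriv, digamma_def, logDeriv_apply Gamma, ofReal_log Real.pi_pos.le]
    field_simp
    ring
  rw [hlog] at h0
  simp at h0
  linarith

end S17
end

section
open Complex MeasureTheory Set

namespace S17

lemma integrable_34 : Integrable (fun y : ℝ => (1 + y^2)^(-(3/4):ℝ)) := by
  have := integrable_rpow_neg_one_add_norm_sq (E := ℝ) (r := 3/2) (μ := volume) (by simp; norm_num)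
  convert this using 3
  · simp
  · norm_num

lemma vert_int {f : ℂ → ℂ} {σ C : ℝ}
    (hd : ∀ s : ℂ, s.re = σ → DifferentiableAt ℂ f s)
    (hb : ∀ s : ℂ, s.re = σ → ‖f s‖ ≤ C * (1 + s.im^2)^(-(3/4):ℝ)) :
    Integrable (fun y : ℝ => f (σ + y * I)) := by
  refine (integrable_34.const_mul C).mono' ?_ (Filter.Eventually.of_forall fun y => ?_)
  · apply Continuous.aestronglyMeasurable
    rw [continuous_iff_continuousAt]
    intro y
    have h1 : ContinuousAt f (σ + y * I) := (hd _ (by simp)).continuousAt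
    exact ContinuousAt.comp (f := fun y : ℝ => (σ + y * I : ℂ)) h1 (by fun_prop)
  · simpa using hb (σ + y * I) (by simp)

lemma vert_shift {f : ℂ → ℂ} {σ0 σ1 C : ℝ} (h01 : σ0 ≤ σ1)
    (hd : ∀ s : ℂ, σ0 ≤ s.re → s.re ≤ σ1 → DifferentiableAt ℂ f s)
    (hb : ∀ s : ℂ, σ0 ≤ s.re → s.re ≤ σ1 → ‖f s‖ ≤ C * (1 + s.im^2)^(-(3/4):ℝ)) :
    ∫ y : ℝ, f (σ0 + y * I) = ∫ y : ℝ, f (σ1 + y * I) := by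
  have i0 : Integrable (fun y : ℝ => f (σ0 + y * I)) :=
    vert_int (fun s hs => hd s hs.ge (hs.le.trans h01)) (fun s hs => hb s hs.ge (hs.le.trans h01))
  have i1 : Integrable (fun y : ℝ => f (σ1 + y * I)) :=
    vert_int (fun s hs => hd s (h01.trans hs.ge) hs.le) (fun s hs => hb s (h01.trans hs.ge) hs.le)
  have t0 := intervalIntegral_tendsto_integral i0 (Filter.tendsto_neg_atTop_atBot (G := ℝ)) Filter.tendsto_id
  have t1 := intervalIntegral_tendsto_integral i1 (Filter.tendsto_neg_atTop_atBot (G := ℝ)) Filter.tendsto_id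
  have hdec : Filter.Tendsto (fun T : ℝ => (C * (1 + T^2)^(-(3/4):ℝ)) * |σ1 - σ0|) Filter.atTop (nhds 0) := by
    have h1 : Filter.Tendsto (fun T : ℝ => 1 + T^2) Filter.atTop Filter.atTop :=
      Filter.tendsto_atTop_add_const_left _ _ (Filter.tendsto_pow_atTop (by norm_num))
    have h2 := (tendsto_rpow_neg_atTop (y := 3/4) (by norm_num)).comp h1
    have h3 := (h2.const_mul C).mul_const |σ1 - σ0|
    simpa [Function.comp_def] using h3
  have hor : ∀ T : ℝ, ‖∫ x : ℝ in σ0..σ1, f (x + T * I)‖ ≤ (C * (1 + T^2)^(-(3/4):ℝ)) * |σ1 - σ0| := by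
    intro T
    apply intervalIntegral.norm_integral_le_of_norm_le_const
    intro x hx
    rw [uIoc_of_le h01] at hx
    simpa using hb (x + T * I) (by simp; exact hx.1.le) (by simp; exact hx.2)
  have h1 : Filter.Tendsto (fun T : ℝ => ∫ x : ℝ in σ0..σ1, f (x + T * I)) Filter.atTop (nhds 0) :=
    squeeze_zero_norm hor hdec
  have h2 : Filter.Tendsto (fun T : ℝ => ∫ x : ℝ in σ0..σ1, f (x + (-T : ℝ) * I)) Filter.atTop (nhds 0) :=
    squeeze_zero_norm (fun T => by simpa using hor (-T)) hdec
  have hrect : ∀ T : ℝ, 0 ≤ T → (∫ x : ℝ in σ0..σ1, f (x + (-T : ℝ) * I)) - (∫ x : ℝ in σ0..σ1, f (x + T * I)) +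
      I • (∫ y : ℝ in (-T)..T, f (σ1 + y * I)) - I • (∫ y : ℝ in (-T)..T, f (σ0 + y * I)) = 0 := by
    intro T hT
    have := integral_boundary_rect_eq_zero_of_differentiableOn f (σ0 + (-T:ℝ) * I) (σ1 + T * I) (by
      intro s hs
      rw [mem_reProdIm] at hs
      have h3 := hs.1
      simp at h3
      rw [uIcc_of_le h01] at h3
      exact (hd s h3.1 h3.2).differentiableWithinAt)
    simpa using this
  have lim := ((h2.sub h1).add (t1.const_smul I)).sub (t0.const_smul I)
  have lim0 : Filter.Tendsto (fun T : ℝ => (∫ x : ℝ in σ0..σ1, f (x + (-T : ℝ) * I)) - (∫ x : ℝ in σ0..σ1, f (x + T * I)) +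
      I • (∫ y : ℝ in (-T)..T, f (σ1 + y * I)) - I • (∫ y : ℝ in (-T)..T, f (σ0 + y * I))) Filter.atTop (nhds 0) := by
    refine tendsto_const_nhds.congr' ?_
    filter_upwards [Filter.eventually_ge_atTop 0] with T hT
    exact (hrect T hT).symm
  have := tendsto_nhds_unique lim lim0
  simp only [sub_zero, zero_add, smul_eq_mul] at this
  rw [← mul_sub] at this
  have h3 := (mul_eq_zero.mp this).resolve_left I_ne_zero
  exact (sub_eq_zero.mp h3).symm

open ArithmeticFunction in
lemma shift_mellin {N : ℕ} [NeZero N] {χ : DirichletCharacter ℂ N} (hχ : χ ≠ 1)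
    (hnz : ∀ s : ℂ, 1/2 < s.re → χ.LFunction s ≠ 0) {δ : ℝ} (hδ : 0 < δ) (hδ' : δ ≤ 1)
    {k : ℂ → ℂ} {f : ℝ → ℂ} {C : ℝ} (hC : 0 ≤ C)
    (hk : ∀ s : ℂ, 1/2 + δ ≤ s.re → s.re ≤ 1 + δ → DifferentiableAt ℂ k s)
    (hkb : ∀ s : ℂ, 1/2 + δ ≤ s.re → s.re ≤ 1 + δ → ‖k s‖ ≤ C / (1 + s.im^2))
    (hf : ∀ s : ℂ, s.re = 1 + δ → HasMellin f s (k s))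
    (hcont : ∀ n : ℕ, 1 ≤ n → ContinuousAt f n) :
    Integrable (fun y : ℝ => logDeriv χ.LFunction ((1/2 + δ : ℝ) + y * I) * k ((1/2 + δ : ℝ) + y * I)) ∧
    ∫ y : ℝ, logDeriv χ.LFunction ((1/2 + δ : ℝ) + y * I) * k ((1/2 + δ : ℝ) + y * I) =
      - (2 * Real.pi * ∑' n : ℕ, χ n * (Λ n : ℂ) * f n) := by
  obtain ⟨C₁, hC₁, hG⟩ := L_growth hχ hnz hδ
  have hLd := DirichletCharacter.differentiable_LFunction hχ
  have hd : ∀ s : ℂ, 1/2 + δ ≤ s.re → s.re ≤ 1 + δ → DifferentiableAt ℂ (fun s => logDeriv χ.LFunction s * k s) s := by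
    intro s h1 h2
    refine DifferentiableAt.mul ?_ (hk s h1 h2)
    exact (hLd.contDiff.differentiable_deriv_two s).div (hLd s) (hnz s (by linarith))
  have hb : ∀ s : ℂ, 1/2 + δ ≤ s.re → s.re ≤ 1 + δ →
      ‖logDeriv χ.LFunction s * k s‖ ≤ 2 * C₁ * C * (1 + s.im^2)^(-(3/4):ℝ) := by
    intro s h1 h2
    rw [norm_mul]
    have a1 := (hG s h1 (by linarith)).1
    have a2 := hkb s h1 h2
    have hpos : 0 < 1 + s.im^2 := by positivity
    have a3 : √(1 + |s.im|) ≤ 2 * (1 + s.im^2)^(1/4:ℝ) := by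
      rw [Real.sqrt_le_left (by positivity), mul_pow, ← Real.rpow_natCast ((1 + s.im^2)^(1/4:ℝ)), ← Real.rpow_mul hpos.le]
      norm_num
      rw [← Real.sqrt_eq_rpow]
      have b1 : 1 ≤ √(1 + s.im^2) := Real.one_le_sqrt.mpr (by nlinarith)
      have b2 : |s.im| ≤ √(1 + s.im^2) := Real.abs_le_sqrt (by linarith)
      linarith
    calc _ ≤ (C₁ * (2 * (1 + s.im^2)^(1/4:ℝ))) * (C / (1 + s.im^2)) := by gcongr; exact a1.trans (by gcongr)
      _ = 2 * C₁ * C * ((1 + s.im^2)^(1/4:ℝ) * (1 + s.im^2)^(-1:ℝ)) := by rw [Real.rpow_neg_one]; ring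
      _ = _ := by rw [← Real.rpow_add hpos]; norm_num
  have h01 : 1/2 + δ ≤ 1 + δ := by linarith
  have hre : ∀ y : ℝ, (((1 + δ : ℝ):ℂ) + y * I).re = 1 + δ := by intro y; simp
  refine ⟨vert_int (f := fun s => logDeriv χ.LFunction s * k s) (fun s hs => hd s hs.ge (hs.le.trans h01)) (fun s hs => hb s hs.ge (hs.le.trans h01)), ?_⟩
  rw [vert_shift (f := fun s => logDeriv χ.LFunction s * k s) h01 hd hb]
  have hkint : Integrable (fun y : ℝ => k ((1 + δ : ℝ) + y * I)) := by
    refine vert_int (C := C) (fun s hs => hk s (h01.trans hs.ge) hs.le) (fun s hs => (hkb s (h01.trans hs.ge) hs.le).trans ?_)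
    rw [div_eq_mul_inv]
    gcongr
    rw [← Real.rpow_neg_one]
    apply Real.rpow_le_rpow_of_exponent_le <;> nlinarith
  -- expand
  have hterm : ∀ y : ℝ, logDeriv χ.LFunction ((1 + δ : ℝ) + y * I) * k ((1 + δ : ℝ) + y * I) =
      ∑' n : ℕ, -(LSeries.term ((fun n : ℕ => χ n) * (fun n : ℕ => (Λ n : ℂ))) ((1 + δ : ℝ) + y * I) n * k ((1 + δ : ℝ) + y * I)) := by
    intro y
    have h1 : 1 < (((1 + δ : ℝ):ℂ) + y * I).re := by rw [hre]; linarith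
    have := DirichletCharacter.LSeries_twist_vonMangoldt_eq χ h1
    rw [tsum_neg, tsum_mul_right, ← LSeries, this, logDeriv_apply, DirichletCharacter.deriv_LFunction_eq_deriv_LSeries χ h1,
      DirichletCharacter.LFunction_eq_LSeries χ h1]
    ring
  have hcoef : ∀ (n : ℕ) (y : ℝ), LSeries.term ((fun n : ℕ => χ n) * (fun n : ℕ => (Λ n : ℂ))) ((1 + δ : ℝ) + y * I) n =
      χ n * (Λ n : ℂ) * (n:ℂ)^(-((1 + δ : ℝ) + y * I)) := by
    intro n y
    rcases eq_or_ne n 0 with rfl | hn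
    · simp
    · rw [LSeries.term_of_ne_zero hn, cpow_neg]; rfl
  have hnorm : ∀ (n : ℕ) (y : ℝ), ‖LSeries.term ((fun n : ℕ => χ n) * (fun n : ℕ => (Λ n : ℂ))) ((1 + δ : ℝ) + y * I) n‖ =
      ‖LSeries.term ((fun n : ℕ => χ n) * (fun n : ℕ => (Λ n : ℂ))) ((1 + δ : ℝ) : ℂ) n‖ := by
    intro n y
    rw [LSeries.norm_term_eq, LSeries.norm_term_eq, hre, ofReal_re]
  have hsum := DirichletCharacter.LSeriesSummable_twist_vonMangoldt χ (s := ((1 + δ : ℝ) : ℂ)) (by rw [ofReal_re]; linarith)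
  have hmeas : ∀ n : ℕ, Continuous (fun y : ℝ => LSeries.term ((fun n : ℕ => χ n) * (fun n : ℕ => (Λ n : ℂ))) ((1 + δ : ℝ) + y * I) n) := by
    intro n
    simp_rw [hcoef]
    rcases eq_or_ne n 0 with rfl | hn
    · simp; exact continuous_const
    · refine continuous_const.mul ?_
      have : (n:ℂ) ≠ 0 := by exact_mod_cast hn
      exact Continuous.const_cpow (by fun_prop) (Or.inl this)
  have hIntegr : ∀ n : ℕ, Integrable (fun y : ℝ => -(LSeries.term ((fun n : ℕ => χ n) * (fun n : ℕ => (Λ n : ℂ))) ((1 + δ : ℝ) + y * I) n * k ((1 + δ : ℝ) + y * I))) := by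
    intro n
    refine (hkint.bdd_mul (hmeas n).aestronglyMeasurable (c := ‖LSeries.term ((fun n : ℕ => χ n) * (fun n : ℕ => (Λ n : ℂ))) ((1 + δ : ℝ) : ℂ) n‖) ?_).neg
    exact Filter.Eventually.of_forall fun y => (hnorm n y).le
  simp_rw [hterm]
  rw [← integral_tsum_of_summable_integral_norm hIntegr]
  · rw [← tsum_mul_left, ← tsum_neg]
    congr 1
    ext n
    rw [integral_neg]
    congr 1
    simp_rw [hcoef, mul_assoc]
    rw [integral_const_mul, integral_const_mul]
    rcases eq_or_ne n 0 with rfl | hn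
    · simp
    · have hvert : VerticalIntegrable (mellin f) (1 + δ) := by
        refine hkint.congr (Filter.Eventually.of_forall fun y => ?_)
        exact (hf _ (hre y)).2.symm
      have hn1 : (0:ℝ) < n := by exact_mod_cast Nat.pos_of_ne_zero hn
      have inv := mellinInv_mellin_eq (1 + δ) f (x := n) hn1 (hf _ (by simp)).1 hvert (hcont n (Nat.pos_of_ne_zero hn))
      rw [mellinInv] at inv
      have e : ∫ y : ℝ, ((n:ℝ) : ℂ)^(-(((1+δ:ℝ):ℂ) + y * I)) • mellin f (((1+δ:ℝ):ℂ) + y * I) = ∫ y : ℝ, (n : ℂ)^(-(((1+δ:ℝ):ℂ) + y * I)) * k (((1+δ:ℝ):ℂ) + y * I) := by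
        congr 1
        ext y
        rw [(hf _ (hre y)).2, smul_eq_mul, ofReal_natCast]
      rw [e] at inv
      rw [← inv, real_smul, ofReal_div, ofReal_mul, ofReal_one, ofReal_ofNat]
      generalize ∫ y : ℝ, (n : ℂ)^(-(((1+δ:ℝ):ℂ) + y * I)) * k (((1+δ:ℝ):ℂ) + y * I) = J
      have : (Real.pi:ℂ) ≠ 0 := by exact_mod_cast Real.pi_ne_zero
      field_simp
  · have : ∀ n : ℕ, ∫ y : ℝ, ‖-(LSeries.term ((fun n : ℕ => χ n) * (fun n : ℕ => (Λ n : ℂ))) ((1 + δ : ℝ) + y * I) n * k ((1 + δ : ℝ) + y * I))‖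
        = ‖LSeries.term ((fun n : ℕ => χ n) * (fun n : ℕ => (Λ n : ℂ))) ((1 + δ : ℝ) : ℂ) n‖ * ∫ y : ℝ, ‖k ((1 + δ : ℝ) + y * I)‖ := by
      intro n
      simp_rw [norm_neg, norm_mul, hnorm]
      rw [integral_const_mul]
    simp_rw [this]
    exact hsum.norm.mul_right _

end S17
end

section
open Complex MeasureTheory Set

namespace S17

lemma hm_congr {f g : ℝ → ℂ} {s m : ℂ} (hf : HasMellin f s m) (h : ∀ u : ℝ, 0 < u → u ≠ 1 → f u = g u) :
    HasMellin g s m := by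
  have hae : ∀ᵐ u : ℝ, u ∈ Ioi (0:ℝ) → (u:ℂ)^(s-1) • f u = (u:ℂ)^(s-1) • g u := by
    have : ∀ᵐ u : ℝ, u ≠ 1 := by
      rw [ae_iff]; simp
    filter_upwards [this] with u hu hu0
    rw [h u hu0 hu]
  refine ⟨?_, ?_⟩
  · exact IntegrableOn.congr_fun_ae hf.1 ((ae_restrict_iff' measurableSet_Ioi).2 hae)
  · rw [← hf.2]
    exact (setIntegral_congr_ae measurableSet_Ioi hae).symm

lemma hm_inv {f : ℝ → ℂ} {s m : ℂ} (hf : HasMellin f (-s) m) :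
    HasMellin (fun t => f t⁻¹) s m := by
  refine ⟨?_, by rw [mellin_comp_inv, hf.2]⟩
  have := (MellinConvergent.comp_rpow (f := f) (s := s) (a := -1) (by norm_num)).2
    (by have := hf.1; simpa [div_neg] using this)
  simpa [Real.rpow_neg_one] using this

lemma hm_shift {f : ℝ → ℂ} {s m a : ℂ} (hf : HasMellin f (s + a) m) :
    HasMellin (fun t => (t:ℂ)^a • f t) s m :=
  ⟨MellinConvergent.cpow_smul.2 hf.1, by rw [mellin_cpow_smul, hf.2]⟩

lemma hm_tz0 {s : ℂ} (hs : 0 < s.re) :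
    HasMellin (fun u : ℝ => ((max (1 - u) 0 : ℝ) : ℂ)) s (1 / (s * (s+1))) := by
  have h1 := hasMellin_one_Ioc hs
  have h2 := hasMellin_cpow_Ioc 1 (s := s) (by simp; linarith)
  have h3 := hasMellin_sub h1.1 h2.1
  rw [h1.2, h2.2] at h3
  have hs0 : s ≠ 0 := by rintro rfl; simp at hs
  have hs1 : s + 1 ≠ 0 := by
    intro h; have := congrArg re h; simp at this; linarith
  have e : 1 / s - 1 / (s+1) = 1 / (s * (s+1)) := by field_simp; ring
  rw [e] at h3
  refine hm_congr h3 fun u hu hu1 => ?_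
  by_cases h : u ≤ 1
  · rw [indicator_of_mem (by exact ⟨hu, h⟩), indicator_of_mem (by exact ⟨hu, h⟩), max_eq_left (by linarith)]
    simp
  · push Not at h
    rw [indicator_of_notMem (by simp [h]), indicator_of_notMem (by simp [h]), max_eq_right (by linarith)]
    simp

lemma hm_tz {s : ℂ} (hs : 0 < s.re) {y : ℝ} (hy : 0 < y) :
    HasMellin (fun u : ℝ => ((max (y - u) 0 : ℝ) : ℂ)) s ((y:ℂ)^(s+1) / (s * (s+1))) := by
  have h := hm_tz0 hs
  have h1 : HasMellin (fun u : ℝ => ((max (1 - y⁻¹ * u) 0 : ℝ) : ℂ)) s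
      (((y⁻¹:ℝ):ℂ)^(-s) • (1 / (s * (s+1)))) := by
    refine ⟨?_, ?_⟩
    · exact (MellinConvergent.comp_mul_left (f := fun u : ℝ => ((max (1 - u) 0 : ℝ) : ℂ)) (inv_pos.2 hy)).2 h.1
    · rw [mellin_comp_mul_left (fun u : ℝ => ((max (1 - u) 0 : ℝ) : ℂ)) s (inv_pos.2 hy), h.2]
  have h2 := hasMellin_const_smul h1.1 (y:ℂ)
  rw [h1.2] at h2
  have e : (y:ℂ) • (((y⁻¹:ℝ):ℂ)^(-s) • (1 / (s * (s+1)))) = (y:ℂ)^(s+1) / (s * (s+1)) := by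
    have hy' : (y:ℂ) ≠ 0 := by exact_mod_cast hy.ne'
    rw [cpow_add _ _ hy', cpow_one, ofReal_inv, cpow_neg, inv_cpow, inv_inv]
    · simp only [smul_eq_mul]; ring
    · rw [arg_ofReal_of_nonneg hy.le]; exact Real.pi_pos.ne
  rw [e] at h2
  refine hm_congr h2 fun u hu hu1 => ?_
  rw [smul_eq_mul, ← ofReal_mul, mul_max_of_nonneg _ _ hy.le]
  congr 2
  · field_simp
  · simp

noncomputable def w (x h u : ℝ) : ℝ := (max (x + h - u) 0 - max (x - u) 0) / h

noncomputable def Kf (x h : ℝ) (s : ℂ) : ℂ :=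
  (((x + h : ℝ):ℂ)^(s+1) - (x:ℂ)^(s+1)) / (h * (s * (s+1)))

lemma w_cont (x h : ℝ) : Continuous (w x h) := by unfold w; fun_prop

lemma w_nonneg {x h u : ℝ} (hh : 0 < h) : 0 ≤ w x h u := by
  unfold w
  apply div_nonneg _ hh.le
  rw [sub_nonneg]; exact max_le_max (by linarith) le_rfl

lemma w_le {x h u : ℝ} (hh : 0 < h) : w x h u ≤ 1 := by
  unfold w
  rw [div_le_one hh, sub_le_iff_le_add]
  apply max_le
  · linarith [le_max_left (x-u) 0]
  · linarith [le_max_right (x-u) 0]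

lemma w_one {x h u : ℝ} (hh : 0 < h) (hu : u ≤ x) : w x h u = 1 := by
  unfold w
  rw [max_eq_left (by linarith), max_eq_left (by linarith), div_eq_one_iff_eq hh.ne']; ring

lemma w_zero {x h u : ℝ} (hh : 0 < h) (hu : x + h ≤ u) : w x h u = 0 := by
  unfold w
  rw [max_eq_right (by linarith), max_eq_right (by linarith)]; simp

lemma hm_w {x h : ℝ} (hx : 0 < x) (hh : 0 < h) {s : ℂ} (hs : 0 < s.re) :
    HasMellin (fun u => ((w x h u : ℝ) : ℂ)) s (Kf x h s) := by
  have h1 := hm_tz hs (add_pos hx hh)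
  have h2 := hm_tz hs hx
  have h3 := hasMellin_sub h1.1 h2.1
  rw [h1.2, h2.2] at h3
  have h4 := hasMellin_const_smul h3.1 ((h:ℂ)⁻¹)
  rw [h3.2] at h4
  convert h4 using 1
  · ext u; unfold w; push_cast; simp only [smul_eq_mul]; rw [div_eq_inv_mul]
  · unfold Kf; rw [smul_eq_mul, ← sub_div, div_mul_eq_div_div_swap, inv_mul_eq_div]

lemma Kf_diff {x h : ℝ} (hx : 0 < x) (hh : 0 < h) {s : ℂ} (hs : 0 < s.re) :
    DifferentiableAt ℂ (Kf x h) s := by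
  have hs0 : s ≠ 0 := by rintro rfl; simp at hs
  have hs1 : s + 1 ≠ 0 := by
    intro h; have := congrArg re h; simp at this; linarith
  unfold Kf
  have h1 : ((x+h:ℝ):ℂ) ≠ 0 := by exact_mod_cast (by positivity : x + h ≠ 0)
  have h2 : (x:ℂ) ≠ 0 := by exact_mod_cast hx.ne'
  have h3 : (h:ℂ) ≠ 0 := by exact_mod_cast hh.ne'
  refine DifferentiableAt.div ?_ (by fun_prop) (by simp [h3, hs0, hs1])
  refine DifferentiableAt.sub ?_ ?_
  · exact DifferentiableAt.const_cpow (by fun_prop) (Or.inl h1)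
  · exact DifferentiableAt.const_cpow (by fun_prop) (Or.inl h2)

/-- crude bound -/
lemma Kf_crude {x h δ : ℝ} (hx : 1 ≤ x) (hh : 0 < h) (hδ : 0 < δ) (hδ1 : δ ≤ 1) {s : ℂ} (hs : δ ≤ s.re) (hs2 : s.re ≤ 2) :
    ‖Kf x h s‖ ≤ (2 * (x+h)^3 / (h * δ^2)) / (1 + s.im^2) := by
  have hx0 : 0 < x := by linarith
  unfold Kf
  rw [norm_div, norm_mul, norm_mul, norm_real, Real.norm_of_nonneg hh.le]
  have a1 : ‖((x+h:ℝ):ℂ)^(s+1) - (x:ℂ)^(s+1)‖ ≤ 2 * (x+h)^3 := by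
    refine (norm_sub_le _ _).trans ?_
    rw [norm_cpow_eq_rpow_re_of_pos (by positivity), norm_cpow_eq_rpow_re_of_pos hx0]
    have b1 : (x+h)^((s+1).re) ≤ (x+h)^3 := by
      rw [← Real.rpow_natCast (x+h) 3]
      apply Real.rpow_le_rpow_of_exponent_le (by linarith)
      simp; linarith
    have b2 : x^((s+1).re) ≤ (x+h)^((s+1).re) := by
      apply Real.rpow_le_rpow hx0.le (by linarith)
      simp; linarith
    linarith
  have a2 : δ^2 * (1 + s.im^2) ≤ ‖s‖ * ‖s+1‖ := by
    have c1 : ‖s‖ ≤ ‖s+1‖ := by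
      rw [← sq_le_sq₀ (by positivity) (by positivity), ← normSq_eq_norm_sq, ← normSq_eq_norm_sq, normSq_apply, normSq_apply]
      simp; nlinarith
    have c2 : δ^2 * (1 + s.im^2) ≤ ‖s‖^2 := by
      rw [← normSq_eq_norm_sq, normSq_apply]
      nlinarith [sq_nonneg s.im, mul_nonneg (sq_nonneg s.im) (by nlinarith : 0 ≤ 1 - δ^2)]
    nlinarith [norm_nonneg s]
  rw [div_div]
  refine div_le_div₀ (by positivity) a1 (by positivity) ?_
  calc h * δ^2 * (1 + s.im^2) = h * (δ^2 * (1 + s.im^2)) := by ring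
    _ ≤ _ := by gcongr

lemma Kf_conj {x h : ℝ} (hx : 0 < x) (hh : 0 < h) (s : ℂ) :
    Kf x h ((starRingEnd ℂ) s) = (starRingEnd ℂ) (Kf x h s) := by
  have key : ∀ y : ℝ, 0 < y → (y:ℂ)^((starRingEnd ℂ) s + 1) = (starRingEnd ℂ) ((y:ℂ)^(s+1)) := by
    intro y hy
    have := cpow_conj (y:ℂ) (s+1) (by rw [arg_ofReal_of_nonneg hy.le]; exact Real.pi_pos.ne)
    rw [conj_ofReal] at this
    rw [← this]; simp
  unfold Kf
  rw [key x hx, key (x+h) (by positivity)]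
  simp

/-- quantitative bound -/
lemma Kf_b1 {x h : ℝ} (hx : 0 < x) (hh : 0 < h) {s : ℂ} (hs : 0 < s.re) :
    ‖Kf x h s‖ ≤ (x+h)^s.re / ‖s‖ := by
  have hs0 : s ≠ 0 := by rintro rfl; simp at hs
  have hs1 : s + 1 ≠ 0 := by
    intro h; have := congrArg re h; simp at this; linarith
  have mv := (convex_Icc x (x+h)).norm_image_sub_le_of_norm_hasDerivWithin_le (f := fun u : ℝ => (u:ℂ)^(s+1))
    (f' := fun u : ℝ => (s+1) * (u:ℂ)^s) (C := ‖s+1‖ * (x+h)^s.re) (x := x) (y := x + h) ?_ ?_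
    (by simp [hh.le]) (by simp [hh.le])
  · simp only [add_sub_cancel_left, Real.norm_of_nonneg hh.le] at mv
    unfold Kf
    rw [norm_div, norm_mul, norm_mul, norm_real, Real.norm_of_nonneg hh.le]
    rw [div_le_div_iff₀ (by positivity) (by positivity)]
    calc _ ≤ (‖s+1‖ * (x+h)^s.re * h) * ‖s‖ := by gcongr
      _ = _ := by ring
  · intro u hu
    have hu0 : 0 < u := lt_of_lt_of_le hx hu.1
    have : HasDerivAt (fun z : ℂ => z^(s+1)) ((s+1) * (u:ℂ)^(s+1-1) * 1) (u:ℂ) :=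
      (hasDerivAt_id (u:ℂ)).cpow_const (Or.inl (by simpa using hu0))
    have := this.comp_ofReal
    simpa using this.hasDerivWithinAt
  · intro u hu
    have hu0 : 0 < u := lt_of_lt_of_le hx hu.1
    rw [norm_mul, norm_cpow_eq_rpow_re_of_pos hu0]
    gcongr
    exact hu.2

lemma Kf_b2 {x h : ℝ} (hx : 0 < x) (hh : 0 < h) {s : ℂ} (hs : 0 < s.re) :
    ‖Kf x h s‖ ≤ 2 * (x+h)^(s.re+1) / (h * ‖s‖^2) := by
  have hs0 : s ≠ 0 := by rintro rfl; simp at hs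
  unfold Kf
  rw [norm_div, norm_mul, norm_mul, norm_real, Real.norm_of_nonneg hh.le]
  have a1 : ‖((x+h:ℝ):ℂ)^(s+1) - (x:ℂ)^(s+1)‖ ≤ 2 * (x+h)^(s.re+1) := by
    refine (norm_sub_le _ _).trans ?_
    rw [norm_cpow_eq_rpow_re_of_pos (by positivity), norm_cpow_eq_rpow_re_of_pos hx]
    have b2 : x^((s+1).re) ≤ (x+h)^((s+1).re) := by
      apply Real.rpow_le_rpow hx.le (by linarith)
      simp; linarith
    have : (s+1).re = s.re + 1 := by simp
    rw [this] at b2 ⊢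
    linarith
  have c1 : ‖s‖ ≤ ‖s+1‖ := by
    rw [← sq_le_sq₀ (by positivity) (by positivity), ← normSq_eq_norm_sq, ← normSq_eq_norm_sq, normSq_apply, normSq_apply]
    simp; nlinarith
  gcongr
  rw [sq]; gcongr

/-- Poisson kernel -/
lemma hm_poisson {σ a : ℝ} {s : ℂ} (h1 : -a < s.re - σ) (h2 : s.re - σ < a) :
    HasMellin (fun u : ℝ => (u:ℂ)^(-σ:ℂ) • (((min u u⁻¹)^a : ℝ) : ℂ)) s (1/(s - σ + a) + 1/(-(s - σ) + a)) := by
  apply hm_shift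
  have k1 := hasMellin_cpow_Ioc (a:ℂ) (s := s + (-σ:ℂ)) (by simp; linarith)
  have k2 := hasMellin_cpow_Ioc (a:ℂ) (s := -(s + (-σ:ℂ))) (by simp; linarith)
  have k3 := hm_inv k2
  have k4 := hasMellin_add k1.1 k3.1
  rw [k1.2, k3.2] at k4
  simp only [← sub_eq_add_neg] at k4
  rw [← sub_eq_add_neg]
  refine hm_congr k4 fun u hu hu1 => ?_
  rcases lt_or_gt_of_ne hu1 with h | h
  · have : 1 < u⁻¹ := (one_lt_inv₀ hu).2 h
    rw [indicator_of_mem (by exact ⟨hu, h.le⟩), indicator_of_notMem (by simp [this]), min_eq_left (by linarith), ofReal_cpow hu.le]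
    simp
  · have : u⁻¹ < 1 := inv_lt_one_of_one_lt₀ h
    rw [indicator_of_notMem (by simp [h]), indicator_of_mem (by exact ⟨by positivity, this.le⟩), min_eq_right (by linarith), ofReal_cpow (by positivity)]
    simp

end S17
end

section
open Complex MeasureTheory Set

namespace S17

/-- the point on the line -/
noncomputable def sl (δ y : ℝ) : ℂ := (1/2 + δ : ℝ) + y * I

lemma sl_re (δ y : ℝ) : (sl δ y).re = 1/2 + δ := by simp [sl]
lemma sl_im (δ y : ℝ) : (sl δ y).im = y := by simp [sl]

lemma zeta_bd : ∃ C : ℝ, 0 < C ∧ ∀ δ : ℝ, 0 < δ → δ ≤ 1 → ∑' n : ℕ, 1 / (n:ℝ)^(1+δ) ≤ C / δ := by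
  have h := tendsto_sub_mul_tsum_nat_rpow
  have h2 := h.eventually (gt_mem_nhds (by norm_num : (1:ℝ) < 2))
  rw [eventually_nhdsWithin_iff, Metric.eventually_nhds_iff] at h2
  obtain ⟨η, hη, h2⟩ := h2
  set M := ∑' n : ℕ, 1 / (n:ℝ)^(1+η/2) with hM
  have hM0 : 0 ≤ M := tsum_nonneg fun n => by positivity
  refine ⟨2 + M, by positivity, fun δ hδ hδ1 => ?_⟩
  rcases lt_or_ge δ η with h3 | h3
  · have := h2 (y := 1 + δ) (by simp [abs_of_pos hδ, h3]) (by simp [hδ])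
    rw [add_sub_cancel_left] at this
    rw [le_div_iff₀ hδ]; nlinarith
  · have : ∑' n : ℕ, 1 / (n:ℝ)^(1+δ) ≤ M := by
      refine Summable.tsum_le_tsum (fun n => ?_) (Real.summable_one_div_nat_rpow.2 (by linarith)) (Real.summable_one_div_nat_rpow.2 (by linarith))
      rcases Nat.eq_zero_or_pos n with rfl | hn
      · simp [Real.zero_rpow (by linarith : 1 + δ ≠ 0), Real.zero_rpow (by linarith : 1 + η/2 ≠ 0)]
      · have : (1:ℝ) ≤ n := by exact_mod_cast hn
        gcongr
        linarith
    rw [le_div_iff₀ hδ]; nlinarith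

open ArithmeticFunction in
lemma mang_bd : ∃ C : ℝ, 0 < C ∧ ∀ δ : ℝ, 0 < δ → δ ≤ 1 →
    Summable (fun n : ℕ => Λ n * (n:ℝ)^(-(1+2*δ))) ∧ ∑' n : ℕ, Λ n * (n:ℝ)^(-(1+2*δ)) ≤ C / δ^2 := by
  obtain ⟨C, hC, h⟩ := zeta_bd
  refine ⟨C, hC, fun δ hδ hδ1 => ?_⟩
  have key : ∀ n : ℕ, Λ n * (n:ℝ)^(-(1+2*δ)) ≤ 1/δ * (1 / (n:ℝ)^(1+δ)) := by
    intro n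
    rcases Nat.eq_zero_or_pos n with rfl | hn
    · simp; positivity
    · have hn' : (0:ℝ) < n := by exact_mod_cast hn
      calc Λ n * (n:ℝ)^(-(1+2*δ)) ≤ ((n:ℝ)^δ/δ) * (n:ℝ)^(-(1+2*δ)) := by
            gcongr
            exact vonMangoldt_le_log.trans (Real.log_le_rpow_div hn'.le hδ)
        _ = 1/δ * ((n:ℝ)^δ * (n:ℝ)^(-(1+2*δ))) := by ring
        _ = 1/δ * (1 / (n:ℝ)^(1+δ)) := by
            rw [← Real.rpow_add hn', one_div ((n:ℝ)^(1+δ)), ← Real.rpow_neg hn'.le]; congr 2; ring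
  have hs : Summable (fun n : ℕ => 1/δ * (1 / (n:ℝ)^(1+δ))) :=
    (Real.summable_one_div_nat_rpow.2 (by linarith)).mul_left _
  have hs2 : Summable (fun n : ℕ => Λ n * (n:ℝ)^(-(1+2*δ))) :=
    Summable.of_nonneg_of_le (fun n => mul_nonneg vonMangoldt_nonneg (by positivity)) key hs
  refine ⟨hs2, (hs2.tsum_le_tsum key hs).trans ?_⟩
  rw [tsum_mul_left]
  calc _ ≤ 1/δ * (C/δ) := by gcongr; exact h δ hδ hδ1
    _ = _ := by rw [sq]; field_simp

open ArithmeticFunction in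
lemma tsum_char_le {N : ℕ} {χ : DirichletCharacter ℂ N} {f : ℕ → ℂ} {g : ℕ → ℝ}
    (hg : Summable (fun n => Λ n * g n)) (h : ∀ n, 1 ≤ n → ‖f n‖ ≤ g n) :
    ‖∑' n : ℕ, χ n * (Λ n : ℂ) * f n‖ ≤ ∑' n : ℕ, Λ n * g n := by
  refine tsum_of_norm_bounded hg.hasSum fun n => ?_
  rcases Nat.eq_zero_or_pos n with rfl | hn
  · simp
  rw [norm_mul, norm_mul, norm_real, Real.norm_of_nonneg vonMangoldt_nonneg]
  have h1 : ‖χ n‖ ≤ 1 := χ.norm_le_one _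
  have h2 := h n hn
  have h3 : 0 ≤ Λ n := vonMangoldt_nonneg
  calc ‖χ n‖ * Λ n * ‖f n‖ ≤ 1 * Λ n * g n := by gcongr
    _ = _ := by ring

section
variable {N : ℕ} [NeZero N] {χ : DirichletCharacter ℂ N}

open ArithmeticFunction in
lemma int_K (hχ : χ ≠ 1) (hnz : ∀ s : ℂ, 1/2 < s.re → χ.LFunction s ≠ 0) {δ : ℝ} (hδ : 0 < δ) (hδ1 : δ ≤ 1)
    {x h : ℝ} (hx : 1 ≤ x) (hh : 0 < h) :
    Integrable (fun y : ℝ => logDeriv χ.LFunction (sl δ y) * Kf x h (sl δ y)) ∧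
    ∫ y : ℝ, logDeriv χ.LFunction (sl δ y) * Kf x h (sl δ y) =
      - (2 * Real.pi * ∑' n : ℕ, χ n * (Λ n : ℂ) * (w x h n : ℂ)) := by
  have hx0 : 0 < x := by linarith
  refine shift_mellin (k := Kf x h) (f := fun u => ((w x h u : ℝ) : ℂ)) (C := 2 * (x+h)^3 / (h * δ^2)) hχ hnz hδ hδ1 (by positivity) ?_ ?_ ?_ ?_
  · intro s h1 h2; exact Kf_diff hx0 hh (by linarith)
  · intro s h1 h2; exact Kf_crude hx hh hδ hδ1 (by linarith) (by linarith)
  · intro s hs; exact hm_w hx0 hh (by linarith)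
  · intro n hn; exact (continuous_ofReal.comp (w_cont x h)).continuousAt

open ArithmeticFunction in
lemma int_Kc (hχ : χ ≠ 1) (hnz : ∀ s : ℂ, 1/2 < s.re → χ.LFunction s ≠ 0) {δ : ℝ} (hδ : 0 < δ) (hδ1 : δ ≤ 1)
    {x h : ℝ} (hx : 1 ≤ x) (hh : 0 < h) :
    Integrable (fun y : ℝ => logDeriv χ.LFunction (sl δ y) * (starRingEnd ℂ) (Kf x h (sl δ y))) ∧
    ‖∫ y : ℝ, logDeriv χ.LFunction (sl δ y) * (starRingEnd ℂ) (Kf x h (sl δ y))‖ ≤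
      2 * Real.pi * ∑' n : ℕ, Λ n * (n:ℝ)^(-(1+2*δ)) := by
  have hx0 : 0 < x := by linarith
  have key := shift_mellin (k := fun s => Kf x h (((1 + 2 * δ : ℝ):ℂ) - s))
    (f := fun u : ℝ => (u:ℂ)^(-((1+2*δ:ℝ):ℂ)) • ((w x h u⁻¹ : ℝ) : ℂ)) (C := 2 * (x+h)^3 / (h * δ^2)) hχ hnz hδ hδ1 (by positivity) ?_ ?_ ?_ ?_
  · have e : ∀ y : ℝ, Kf x h (((1 + 2 * δ : ℝ):ℂ) - ((1/2 + δ : ℝ) + y * I)) = (starRingEnd ℂ) (Kf x h (sl δ y)) := by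
      intro y
      rw [← Kf_conj hx0 hh]
      congr 1
      apply Complex.ext <;> simp [sl]
      ring
    simp only [e] at key
    refine ⟨key.1, ?_⟩
    have := key.2
    unfold sl at this ⊢
    rw [this, norm_neg, norm_mul]
    have e2 : ‖(2 * (Real.pi:ℂ))‖ = 2 * Real.pi := by simp [abs_of_pos Real.pi_pos]
    rw [e2]
    gcongr
    obtain ⟨C, hC, hm⟩ := mang_bd
    refine tsum_char_le (hm δ hδ hδ1).1 fun n hn => ?_
    have hn' : (0:ℝ) < n := by exact_mod_cast hn
    rw [norm_smul, norm_cpow_eq_rpow_re_of_pos hn', norm_real, Real.norm_of_nonneg (w_nonneg hh)]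
    simp only [neg_re, ofReal_re]
    calc _ ≤ (n:ℝ)^(-(1+2*δ)) * 1 := by gcongr; exact w_le hh
      _ = _ := by ring
  · intro s h1 h2
    have : DifferentiableAt ℂ (Kf x h) (((1 + 2 * δ : ℝ):ℂ) - s) := Kf_diff hx0 hh (by rw [sub_re, ofReal_re]; linarith)
    exact this.comp s (by fun_prop)
  · intro s h1 h2
    have := Kf_crude hx hh hδ hδ1 (s := ((1 + 2 * δ : ℝ):ℂ) - s) (by rw [sub_re, ofReal_re]; linarith) (by rw [sub_re, ofReal_re]; linarith)
    simpa only [sub_im, ofReal_im, zero_sub, neg_sq] using this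
  · intro s hs
    apply hm_shift
    apply hm_inv (f := fun u => ((w x h u : ℝ) : ℂ))
    have := hm_w hx0 hh (s := ((1 + 2 * δ : ℝ):ℂ) - s) (by rw [sub_re, ofReal_re]; linarith)
    convert this using 1
    ring
  · intro n hn
    have hn' : (0:ℝ) < n := by exact_mod_cast hn
    simp only [smul_eq_mul]
    refine ContinuousAt.mul ?_ ?_
    · exact continuousAt_ofReal_cpow_const _ _ (Or.inr hn'.ne')
    · exact (continuous_ofReal.comp (w_cont x h)).continuousAt.comp (continuousAt_inv₀ hn'.ne')

open ArithmeticFunction in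
lemma int_poisson : ∃ C : ℝ, 0 < C ∧ ∀ {N : ℕ} [NeZero N] {χ : DirichletCharacter ℂ N}, χ ≠ 1 → (∀ s : ℂ, 1/2 < s.re → χ.LFunction s ≠ 0) → ∀ {δ : ℝ}, 0 < δ → δ ≤ 1 →
    ∀ {a : ℝ}, 1 ≤ a →
    Integrable (fun y : ℝ => (logDeriv χ.LFunction (sl δ y)).re * (a / (a^2+y^2))) ∧
    |∫ y : ℝ, (logDeriv χ.LFunction (sl δ y)).re * (a / (a^2+y^2))| ≤ C := by
  obtain ⟨C, hC, hm⟩ := mang_bd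
  refine ⟨Real.pi * (C/(1/4)^2), by positivity, fun {N} _ {χ} hχ hnz {δ} hδ hδ1 {a} ha => ?_⟩
  have hcf : ∀ n : ℕ, 1 ≤ n → ContinuousAt (fun u : ℝ => (u:ℂ)^(-((1/2+δ:ℝ):ℂ)) • (((min u u⁻¹)^a : ℝ) : ℂ)) (n:ℝ) := by
    intro n hn
    have hn' : (0:ℝ) < n := by exact_mod_cast hn
    simp only [smul_eq_mul]
    refine ContinuousAt.mul ?_ ?_
    · exact continuousAt_ofReal_cpow_const _ _ (Or.inr hn'.ne')
    · refine continuous_ofReal.continuousAt.comp ?_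
      refine ContinuousAt.rpow_const ?_ (Or.inr (by linarith))
      exact continuousAt_id.min (continuousAt_inv₀ hn'.ne')
  have hne : ∀ s : ℂ, 1/2 + δ ≤ s.re → s.re ≤ 1 + δ →
      (1 + s.im^2)/4 ≤ ‖s - ((1/2+δ:ℝ):ℂ) + a‖ * ‖-(s - ((1/2+δ:ℝ):ℂ)) + a‖ ∧
      s - ((1/2+δ:ℝ):ℂ) + a ≠ 0 ∧ -(s - ((1/2+δ:ℝ):ℂ)) + a ≠ 0 := by
    intro s h1 h2
    have k1 : (1 + s.im^2)/4 ≤ ‖s - ((1/2+δ:ℝ):ℂ) + a‖^2 := by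
      rw [← normSq_eq_norm_sq, normSq_apply]
      simp only [add_re, sub_re, ofReal_re, add_im, sub_im, ofReal_im]
      nlinarith [sq_nonneg s.im]
    have k2 : (1 + s.im^2)/4 ≤ ‖-(s - ((1/2+δ:ℝ):ℂ)) + a‖^2 := by
      rw [← normSq_eq_norm_sq, normSq_apply]
      simp only [add_re, sub_re, ofReal_re, add_im, sub_im, ofReal_im, neg_re, neg_im]
      nlinarith [sq_nonneg s.im]
    have k0 : 0 < (1 + s.im^2)/4 := by positivity
    refine ⟨?_, ?_, ?_⟩
    · rw [← sq_le_sq₀ k0.le (by positivity), mul_pow, sq ((1+s.im^2)/4)]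
      gcongr
    · intro h; rw [h] at k1; simp at k1; linarith
    · intro h; rw [h] at k2; simp at k2; linarith
  have key := shift_mellin (k := fun s => 1/(s - ((1/2+δ:ℝ):ℂ) + a) + 1/(-(s - ((1/2+δ:ℝ):ℂ)) + a))
    (f := fun u : ℝ => (u:ℂ)^(-((1/2+δ:ℝ):ℂ)) • (((min u u⁻¹)^a : ℝ) : ℂ)) (C := 8*a) hχ hnz hδ hδ1 (by positivity) ?_ ?_ ?_ hcf
  · have e : ∀ y : ℝ, 1/(((1/2 + δ : ℝ) + y * I) - ((1/2+δ:ℝ):ℂ) + a) + 1/(-(((1/2 + δ : ℝ) + y * I) - ((1/2+δ:ℝ):ℂ)) + a)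
        = ((2 * (a / (a^2+y^2)) : ℝ) : ℂ) := by
      intro y
      have h1 : (y * I + a : ℂ) ≠ 0 := by
        intro h; have := congrArg re h; simp at this; linarith
      have h2 : (-(y * I) + a : ℂ) ≠ 0 := by
        intro h; have := congrArg re h; simp at this; linarith
      have h3 : (a:ℂ)^2 + (y:ℂ)^2 = (y * I + a : ℂ) * (-(y * I) + a : ℂ) := by
        ring_nf; simp
      rw [add_sub_cancel_left]
      push_cast
      rw [h3]
      field_simp
      ring
    simp only [e] at key
    change Integrable (fun y : ℝ => logDeriv χ.LFunction (sl δ y) * _) ∧ ∫ y : ℝ, logDeriv χ.LFunction (sl δ y) * _ = _ at key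
    have e3 : ∀ y : ℝ, (logDeriv χ.LFunction (sl δ y)).re * (a / (a^2+y^2)) = 1/2 * (logDeriv χ.LFunction (sl δ y) * ((2 * (a / (a^2+y^2)) : ℝ) : ℂ)).re := by
      intro y; rw [re_mul_ofReal]; ring
    simp only [e3]
    refine ⟨key.1.re.const_mul _, ?_⟩
    rw [integral_const_mul]
    have e4 : ∫ y : ℝ, (logDeriv χ.LFunction (sl δ y) * ((2 * (a / (a^2+y^2)) : ℝ) : ℂ)).re = (∫ y : ℝ, logDeriv χ.LFunction (sl δ y) * ((2 * (a / (a^2+y^2)) : ℝ) : ℂ)).re := by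
      exact integral_re key.1
    rw [e4, abs_mul]
    have := key.2
    have b1 := abs_re_le_norm (∫ y : ℝ, logDeriv χ.LFunction (sl δ y) * ((2 * (a / (a^2+y^2)) : ℝ) : ℂ))
    rw [this, norm_neg, norm_mul] at b1
    have e2 : ‖(2 * (Real.pi:ℂ))‖ = 2 * Real.pi := by simp [abs_of_pos Real.pi_pos]
    rw [e2] at b1
    have b2 : ‖∑' n : ℕ, χ n * (Λ n : ℂ) * (((n:ℝ):ℂ)^(-((1/2+δ:ℝ):ℂ)) • (((min (n:ℝ) (n:ℝ)⁻¹)^a : ℝ) : ℂ))‖ ≤ C/(1/4)^2 := by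
      refine (tsum_char_le (hm (1/4) (by norm_num) (by norm_num)).1 fun n hn => ?_).trans (hm (1/4) (by norm_num) (by norm_num)).2
      have hn' : (1:ℝ) ≤ n := by exact_mod_cast hn
      have hn0 : (0:ℝ) < n := by linarith
      have hmin : min (n:ℝ) (n:ℝ)⁻¹ = (n:ℝ)⁻¹ := min_eq_right ((inv_le_one_of_one_le₀ hn').trans hn')
      rw [hmin, norm_smul, norm_cpow_eq_rpow_re_of_pos hn0, norm_real, Real.norm_of_nonneg (by positivity), Real.inv_rpow hn0.le, ← Real.rpow_neg hn0.le, ← Real.rpow_add hn0]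
      apply Real.rpow_le_rpow_of_exponent_le hn'
      simp only [neg_re, ofReal_re]; linarith
    have b3 := b1.trans (mul_le_mul_of_nonneg_left b2 (by positivity))
    rw [← this] at b3
    rw [abs_of_pos (by norm_num : (0:ℝ) < 1/2)]
    linarith
  · intro s h1 h2
    obtain ⟨_, q1, q2⟩ := hne s h1 h2
    refine DifferentiableAt.fun_add (DifferentiableAt.fun_div (by fun_prop) (by fun_prop) q1) (DifferentiableAt.fun_div (by fun_prop) (by fun_prop) q2)
  · intro s h1 h2
    obtain ⟨q0, q1, q2⟩ := hne s h1 h2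
    have : 1/(s - ((1/2+δ:ℝ):ℂ) + a) + 1/(-(s - ((1/2+δ:ℝ):ℂ)) + a) = 2 * a / ((s - ((1/2+δ:ℝ):ℂ) + a) * (-(s - ((1/2+δ:ℝ):ℂ)) + a)) := by
      rw [div_add_div _ _ q1 q2]; congr 1; ring
    rw [this, norm_div, norm_mul, norm_mul, norm_real, Real.norm_of_nonneg (by linarith)]
    have : (8 * a / (1 + s.im^2)) = 2 * a / ((1 + s.im^2)/4) := by field_simp; norm_num
    rw [this]
    simp only [Complex.norm_ofNat]
    gcongr
  · intro s hs
    have := hm_poisson (σ := 1/2+δ) (a := a) (s := s) (by linarith) (by linarith)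
    exact this

end

end S17
end

section
open Complex MeasureTheory Set

namespace S17

lemma re_lower : ∃ C : ℝ, 0 < C ∧ ∀ {N : ℕ} [NeZero N] {χ : DirichletCharacter ℂ N}, χ ≠ 1 → χ.IsPrimitive →
    (∀ s : ℂ, 1/2 < s.re → χ.LFunction s ≠ 0) → ∀ {δ : ℝ}, 0 < δ → δ ≤ 1 → ∀ y : ℝ,
    0 ≤ (logDeriv χ.LFunction (sl δ y)).re + (Real.log N + C * (1 + Real.log (2 + |y|))) := by
  obtain ⟨C, hC, hd⟩ := digamma_upper
  refine ⟨C, hC, fun {N} _ {χ} hχ hp hnz {δ} hδ hδ1 y => ?_⟩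
  have h1 := pos_main hχ hp hnz (s := sl δ y) (by rw [sl_re]; linarith)
  have hp0 := par_nonneg χ
  have hp1 := par_le χ
  have hre : ((sl δ y + par χ)/2).re = (1/2 + δ + par χ)/2 := by
    have : ((sl δ y + par χ)/2) = ((1/2:ℝ):ℂ) * (sl δ y + par χ) := by push_cast; ring
    rw [this, re_ofReal_mul, add_re, sl_re, ofReal_re]; ring
  have h2 := hd ((sl δ y + par χ)/2) (by rw [hre]; linarith)
  have hN : 0 ≤ Real.log N := Real.log_natCast_nonneg N
  have hpi : 0 ≤ Real.log Real.pi := Real.log_nonneg (by linarith [Real.pi_gt_three])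
  have hn : ‖(sl δ y + par χ)/2‖ ≤ 2 + |y| := by
    have a1 : ‖sl δ y + par χ‖ ≤ (1/2 + δ) + |y| + par χ := by
      unfold sl
      refine (norm_add_le _ _).trans ?_
      rw [norm_real, Real.norm_of_nonneg hp0]
      gcongr
      refine (norm_add_le _ _).trans ?_
      rw [norm_real, Real.norm_of_nonneg (by linarith)]
      simp
    rw [norm_div, Complex.norm_ofNat]
    have := abs_nonneg y
    linarith
  have h3 : Real.log (2 + ‖(sl δ y + par χ)/2‖) ≤ 1 + Real.log (2 + |y|) := by
    have hy := abs_nonneg y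
    calc _ ≤ Real.log (2 * (2 + |y|)) := Real.log_le_log (by positivity) (by linarith)
      _ = Real.log 2 + Real.log (2 + |y|) := Real.log_mul (by norm_num) (by positivity)
      _ ≤ _ := by linarith [Real.log_two_lt_d9]
  have h4 : 0 ≤ Real.log (2 + |y|) := Real.log_nonneg (by linarith [abs_nonneg y])
  have h5 : C * (1 + Real.log (2 + ‖(sl δ y + par χ)/2‖)) ≤ C * (2 + Real.log (2 + |y|)) := by
    apply mul_le_mul_of_nonneg_left _ hC.le; linarith
  have h6 : 0 ≤ C * Real.log (2 + |y|) := by positivity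
  nlinarith

lemma log_one_add_le {v : ℝ} (hv : 0 ≤ v) : Real.log (1 + v) ≤ 3 * (1 + v^2)^(1/4:ℝ) := by
  have h1 : Real.log (1+v) ≤ (1+v)^(1/2:ℝ)/(1/2) := Real.log_le_rpow_div (by linarith) (by norm_num)
  have h2 : (1+v)^(1/2:ℝ) = ((1+v)^2)^(1/4:ℝ) := by
    rw [← Real.rpow_natCast, ← Real.rpow_mul (by linarith)]; norm_num
  have h3 : ((1+v)^2)^(1/4:ℝ) ≤ (2*(1+v^2))^(1/4:ℝ) := by
    apply Real.rpow_le_rpow (by positivity) _ (by norm_num)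
    nlinarith [sq_nonneg (1-v)]
  rw [Real.mul_rpow (by norm_num) (by positivity)] at h3
  have h4 : (2:ℝ)^(1/4:ℝ) ≤ 3/2 := by
    have : (3/2:ℝ) = ((3/2:ℝ)^(4:ℕ))^(1/4:ℝ) := by
      rw [← Real.rpow_natCast, ← Real.rpow_mul (by norm_num)]; norm_num
    rw [this]
    apply Real.rpow_le_rpow (by norm_num) (by norm_num) (by norm_num)
  have h5 : 0 ≤ (1+v^2)^(1/4:ℝ) := by positivity
  nlinarith

lemma abs_re_poisson : ∃ C : ℝ, 0 < C ∧ ∀ {N : ℕ} [NeZero N] {χ : DirichletCharacter ℂ N}, χ ≠ 1 → χ.IsPrimitive →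
    (∀ s : ℂ, 1/2 < s.re → χ.LFunction s ≠ 0) → ∀ {δ : ℝ}, 0 < δ → δ ≤ 1 → ∀ {a : ℝ}, 1 ≤ a →
    Integrable (fun y : ℝ => |(logDeriv χ.LFunction (sl δ y)).re| * (a / (a^2+y^2))) ∧
    ∫ y : ℝ, |(logDeriv χ.LFunction (sl δ y)).re| * (a / (a^2+y^2)) ≤ C * (1 + Real.log N + Real.log (2 + a)) := by
  obtain ⟨C0, hC0, hP⟩ := int_poisson
  obtain ⟨C1, hC1, hR⟩ := re_lower
  set M := ∫ y : ℝ, (1 + y^2)^(-(3/4):ℝ) with hM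
  have hM0 : 0 ≤ M := integral_nonneg fun y => by positivity
  refine ⟨C0 + 2 * (1 + 4 * C1) * M, by positivity, fun {N} _ {χ} hχ hp hnz {δ} hδ hδ1 {a} ha => ?_⟩
  obtain ⟨hi, hb⟩ := hP hχ hnz hδ hδ1 ha
  have ha0 : 0 < a := by linarith
  set R := fun y : ℝ => (logDeriv χ.LFunction (sl δ y)).re with hRdef
  have hia : Integrable (fun y : ℝ => |R y| * (a / (a^2+y^2))) := by
    refine hi.abs.congr (Filter.Eventually.of_forall fun y => ?_)
    simp only [hRdef, abs_mul]
    rw [abs_of_pos (by positivity : 0 < a/(a^2+y^2))]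
  refine ⟨hia, ?_⟩
  set W := Real.log N + C1 * (4 + Real.log (2 + a)) with hW
  have hN : 0 ≤ Real.log N := Real.log_natCast_nonneg N
  have hla : 0 ≤ Real.log (2 + a) := Real.log_nonneg (by linarith)
  have hU : ∀ y : ℝ, (Real.log N + C1 * (1 + Real.log (2 + |y|))) * (a / (a^2+y^2)) ≤
      W * (a⁻¹ * (1 + (a⁻¹ * y)^2)^(-(3/4):ℝ)) := by
    intro y
    have hy := abs_nonneg y
    set q := 1 + (a⁻¹ * y)^2 with hq
    have hq1 : 1 ≤ q := by rw [hq]; nlinarith [sq_nonneg (a⁻¹ * y)]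
    have hq0 : 0 < q := by linarith
    have e1 : a / (a^2+y^2) = a⁻¹ * (q^(-(3/4):ℝ) * q^(-(1/4):ℝ)) := by
      rw [← Real.rpow_add hq0]; norm_num
      rw [Real.rpow_neg_one, hq]; field_simp
    have l1 : Real.log (2 + |y|) ≤ Real.log (2 + a) + 3 * q^(1/4:ℝ) := by
      calc _ ≤ Real.log ((2 + a) * (1 + a⁻¹ * |y|)) := by
            apply Real.log_le_log (by positivity)
            have : (2 + a) * (1 + a⁻¹ * |y|) = 2 + a + 2 * a⁻¹ * |y| + |y| := by field_simp; ring
            rw [this]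
            have : 0 ≤ 2 * a⁻¹ * |y| := by positivity
            linarith
        _ = Real.log (2 + a) + Real.log (1 + a⁻¹ * |y|) := Real.log_mul (by positivity) (by positivity)
        _ ≤ _ := by
            gcongr
            have := log_one_add_le (v := a⁻¹ * |y|) (by positivity)
            rwa [mul_pow, sq_abs, ← mul_pow, ← hq] at this
    have l2 : 1 ≤ q^(1/4:ℝ) := Real.one_le_rpow hq1 (by norm_num)
    have l3 : (Real.log N + C1 * (1 + Real.log (2 + |y|))) ≤ W * q^(1/4:ℝ) := by
      have : C1 * (1 + Real.log (2 + |y|)) ≤ C1 * (4 + Real.log (2+a)) * q^(1/4:ℝ) := by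
        rw [mul_assoc]; gcongr; nlinarith
      rw [hW]; nlinarith
    rw [e1]
    calc _ ≤ W * q^(1/4:ℝ) * (a⁻¹ * (q^(-(3/4):ℝ) * q^(-(1/4):ℝ))) := by gcongr
      _ = W * (a⁻¹ * q^(-(3/4):ℝ)) * (q^(1/4:ℝ) * q^(-(1/4):ℝ)) := by ring
      _ = _ := by rw [← Real.rpow_add hq0]; norm_num
  have hii : Integrable (fun y : ℝ => W * (a⁻¹ * (1 + (a⁻¹ * y)^2)^(-(3/4):ℝ))) :=
    ((integrable_34.comp_mul_left' (inv_ne_zero ha0.ne')).const_mul _).const_mul _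
  have hval : ∫ y : ℝ, W * (a⁻¹ * (1 + (a⁻¹ * y)^2)^(-(3/4):ℝ)) = W * M := by
    rw [integral_const_mul, integral_const_mul]
    rw [Measure.integral_comp_mul_left (fun y : ℝ => (1 + y^2)^(-(3/4):ℝ)) a⁻¹, inv_inv, abs_of_pos ha0, smul_eq_mul, ← hM]
    field_simp
  have hpt : ∀ y : ℝ, |R y| * (a / (a^2+y^2)) ≤ R y * (a / (a^2+y^2)) + 2 * (W * (a⁻¹ * (1 + (a⁻¹ * y)^2)^(-(3/4):ℝ))) := by
    intro y
    have h1 := hR hχ hp hnz hδ hδ1 y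
    have h2 := hU y
    have h3 : |R y| ≤ R y + 2 * (Real.log N + C1 * (1 + Real.log (2 + |y|))) := by
      have h4 : 0 ≤ Real.log (2 + |y|) := Real.log_nonneg (by linarith [abs_nonneg y])
      have h5 : 0 ≤ C1 * (1 + Real.log (2 + |y|)) := by positivity
      rw [abs_le]; constructor <;> simp only [hRdef] <;> linarith
    have h6 : 0 ≤ a / (a^2+y^2) := by positivity
    nlinarith [mul_le_mul_of_nonneg_right h3 h6]
  calc _ ≤ ∫ y, (R y * (a / (a^2+y^2)) + 2 * (W * (a⁻¹ * (1 + (a⁻¹ * y)^2)^(-(3/4):ℝ)))) :=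
        integral_mono hia (hi.add (hii.const_mul 2)) hpt
    _ = (∫ y, R y * (a / (a^2+y^2))) + 2 * (W * M) := by
        rw [integral_add hi (hii.const_mul 2), integral_const_mul, hval]
    _ ≤ C0 + 2 * (W * M) := by linarith [(abs_le.1 hb).2]
    _ ≤ _ := by
        have : W ≤ (1 + 4 * C1) * (1 + Real.log N + Real.log (2 + a)) := by
          rw [hW]
          have := mul_nonneg hC1.le hN
          have := mul_nonneg hC1.le hla
          nlinarith
        have := mul_le_mul_of_nonneg_right this hM0
        have : C0 ≤ C0 * (1 + Real.log N + Real.log (2 + a)) := by nlinarith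
        linarith

lemma dyadic1 (J : ℕ) : ∀ y : ℝ, 1 ≤ |y| → |y| ≤ 2^J → 1/|y| ≤ 5 * ∑ j ∈ Finset.range J, (2:ℝ)^j/(((2:ℝ)^j)^2+y^2) + if |y| = 2^J then 1/|y| else 0 := by
  induction J with
  | zero => intro y h1 h2; have : |y| = 1 := le_antisymm (by simpa using h2) h1
            simp [this]
  | succ J ih =>
    intro y h1 h2
    have hy0 : 0 < |y| := by linarith
    have hnn : ∀ j : ℕ, 0 ≤ (2:ℝ)^j/(((2:ℝ)^j)^2+y^2) := fun j => by positivity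
    rw [Finset.sum_range_succ]
    have hif : (0:ℝ) ≤ if |y| = 2^(J+1) then 1/|y| else 0 := by split_ifs <;> positivity
    rcases lt_or_ge |y| (2^J) with h | h
    · have := ih y h1 h.le
      rw [if_neg h.ne] at this
      linarith [hnn J]
    · have hs : 0 ≤ ∑ j ∈ Finset.range J, (2:ℝ)^j/(((2:ℝ)^j)^2+y^2) := Finset.sum_nonneg fun j _ => hnn j
      have : 1/|y| ≤ 5 * ((2:ℝ)^J/(((2:ℝ)^J)^2+y^2)) := by
        rw [← sq_abs y]
        set v := |y|
        set T := (2:ℝ)^J with hT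
        have hT0 : 0 < T := by positivity
        have h2' : v ≤ 2 * T := by rw [hT]; rw [pow_succ] at h2; linarith
        rw [← mul_div_assoc, div_le_div_iff₀ hy0 (by positivity)]
        nlinarith
      linarith

lemma kernel_bd {E x v s y : ℝ} (hE : 0 ≤ E) (hx : 0 ≤ x) (J : ℕ) (hJ : x ≤ 2^J) (hs : 1/2 ≤ s) (hsy : |y| ≤ s)
    (h1 : v ≤ E / s) (h2 : v ≤ E * (4 * x) / s^2) :
    v ≤ 8 * E * ∑ j ∈ Finset.range (J+1), (2:ℝ)^j/(((2:ℝ)^j)^2+y^2) := by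
  have hnn : ∀ j : ℕ, 0 ≤ (2:ℝ)^j/(((2:ℝ)^j)^2+y^2) := fun j => by positivity
  have hsum : ∀ j ≤ J, (2:ℝ)^j/(((2:ℝ)^j)^2+y^2) ≤ ∑ j ∈ Finset.range (J+1), (2:ℝ)^j/(((2:ℝ)^j)^2+y^2) := by
    intro j hj
    exact Finset.single_le_sum (f := fun j => (2:ℝ)^j/(((2:ℝ)^j)^2+y^2)) (fun j _ => hnn j) (by simp; omega)
  have hs0 : 0 < s := by linarith
  suffices H : (∃ u, 0 ≤ u ∧ v ≤ E * u ∧ u ≤ 8 * ∑ j ∈ Finset.range (J+1), (2:ℝ)^j/(((2:ℝ)^j)^2+y^2)) by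
    obtain ⟨u, hu, hv, hu2⟩ := H
    calc v ≤ E * u := hv
      _ ≤ E * (8 * ∑ j ∈ Finset.range (J+1), (2:ℝ)^j/(((2:ℝ)^j)^2+y^2)) := by gcongr
      _ = _ := by ring
  rcases lt_or_ge |y| 1 with h | h
  · refine ⟨2, by norm_num, ?_, ?_⟩
    · refine h1.trans ?_
      rw [div_le_iff₀ hs0]; nlinarith
    · have := hsum 0 (by omega)
      have h3 : (1:ℝ)/2 ≤ (2:ℝ)^0/(((2:ℝ)^0)^2+y^2) := by
        rw [← sq_abs y, div_le_div_iff₀ (by norm_num) (by positivity)]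
        nlinarith [abs_nonneg y]
      linarith
  rcases lt_or_ge |y| (2^J) with h' | h'
  · refine ⟨1/|y|, by positivity, ?_, ?_⟩
    · refine h1.trans ?_
      rw [mul_one_div]; gcongr
    · have := dyadic1 J y h h'.le
      rw [if_neg h'.ne] at this
      rw [Finset.sum_range_succ]
      have : 0 ≤ ∑ j ∈ Finset.range J, (2:ℝ)^j/(((2:ℝ)^j)^2+y^2) := Finset.sum_nonneg fun j _ => hnn j
      linarith [hnn J]
  · refine ⟨4 * x/|y|^2, by positivity, ?_, ?_⟩
    · refine h2.trans ?_
      rw [mul_div_assoc]; gcongr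
    · refine le_trans ?_ (mul_le_mul_of_nonneg_left (hsum J le_rfl) (by norm_num))
      rw [← sq_abs y]
      have hT0 : 0 < (2:ℝ)^J := by positivity
      generalize (2:ℝ)^J = T at *
      rw [← mul_div_assoc, div_le_div_iff₀ (by positivity) (by positivity)]
      have : T^2 ≤ |y|^2 := by gcongr
      have a1 : 4 * x * (T^2 + |y|^2) ≤ 4 * x * (2 * |y|^2) := by gcongr; linarith
      nlinarith [sq_nonneg |y|]

end S17
end

section
open Complex MeasureTheory Set

namespace S17

open ArithmeticFunction in
lemma smooth_main : ∃ C : ℝ, 0 < C ∧ ∀ {N : ℕ} [NeZero N] {χ : DirichletCharacter ℂ N}, χ ≠ 1 → χ.IsPrimitive →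
    (∀ s : ℂ, 1/2 < s.re → χ.LFunction s ≠ 0) → ∀ x : ℝ, 3 ≤ x → (N:ℝ) ≤ x^2 →
    ‖∑' n : ℕ, χ n * (Λ n : ℂ) * (w x (Real.sqrt x) n : ℂ)‖ ≤ C * Real.sqrt x * (Real.log x)^2 := by
  obtain ⟨C1, hC1, hA⟩ := abs_re_poisson
  obtain ⟨C2, hC2, hB⟩ := mang_bd
  refine ⟨C2 + 64 * 21 * C1, by positivity, fun {N} _ {χ} hχ hp hnz x hx hN => ?_⟩
  have hx0 : 0 < x := by linarith
  set h := Real.sqrt x with hh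
  have hh1 : 1 ≤ h := by rw [hh]; exact Real.one_le_sqrt.2 (by linarith)
  have hh0 : 0 < h := by linarith
  have hhx : h^2 = x := Real.sq_sqrt hx0.le
  set L := Real.log x with hL
  have hL1 : 1 ≤ L := by
    rw [hL, Real.le_log_iff_exp_le hx0]; linarith [Real.exp_one_lt_d9]
  have hL0 : 0 < L := by linarith
  set δ := 1 / L with hδ
  have hδ0 : 0 < δ := by positivity
  have hδ1 : δ ≤ 1 := by rw [hδ, div_le_one hL0]; exact hL1
  obtain ⟨i1, e1⟩ := int_K hχ hnz hδ0 hδ1 (x := x) (h := h) (by linarith) hh0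
  obtain ⟨i2, e2⟩ := int_Kc hχ hnz hδ0 hδ1 (x := x) (h := h) (by linarith) hh0
  have hB' := (hB δ hδ0 hδ1).2
  set G := fun y : ℝ => logDeriv χ.LFunction (sl δ y) with hG
  set K := fun y : ℝ => Kf x h (sl δ y) with hK
  set S := ∑' n : ℕ, χ n * (Λ n : ℂ) * (w x h n : ℂ) with hS
  -- kernel bound
  set J := ⌈L⌉₊ with hJ
  have hJ1 : L ≤ J := Nat.le_ceil _
  have hJ2 : (J:ℝ) ≤ 2 * L := by linarith [Nat.ceil_lt_add_one hL0.le]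
  have hJx : h ≤ 2^J := by
    have : Real.log h ≤ Real.log (2^J) := by
      rw [Real.log_pow, hh, Real.log_sqrt hx0.le, ← hL]
      nlinarith [Real.log_two_gt_d9]
    exact (Real.log_le_log_iff hh0 (by positivity)).1 this
  have hpow : (x+h)^(1/2+δ) ≤ 8 * h := by
    have a1 : x + h ≤ 2 * x := by nlinarith
    calc (x+h)^(1/2+δ) ≤ (2*x)^(1/2+δ) := by gcongr
      _ = 2^(1/2+δ) * (x^(1/2:ℝ) * x^δ) := by
          rw [Real.mul_rpow (by norm_num) hx0.le, Real.rpow_add hx0]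
      _ = 2^(1/2+δ) * (h * Real.exp 1) := by
          rw [← Real.sqrt_eq_rpow, ← hh]
          congr 2
          rw [Real.rpow_def_of_pos hx0, ← hL, hδ]; congr 1; field_simp
      _ ≤ (2.9) * (h * Real.exp 1) := by
          gcongr
          calc (2:ℝ)^(1/2+δ) ≤ 2^(3/2:ℝ) := by
                apply Real.rpow_le_rpow_of_exponent_le (by norm_num); linarith
            _ = 2 * Real.sqrt 2 := by
                rw [Real.sqrt_eq_rpow, ← Real.rpow_one_add' (by norm_num) (by norm_num)]; norm_num
            _ ≤ 2.9 := by
                have : Real.sqrt 2 ≤ 1.45 := by rw [Real.sqrt_le_left (by norm_num)]; norm_num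
                linarith
      _ ≤ 8 * h := by nlinarith [Real.exp_one_lt_d9]
  have hKb : ∀ y : ℝ, ‖K y‖ ≤ 8 * (8*h) * ∑ j ∈ Finset.range (J+1), (2:ℝ)^j/(((2:ℝ)^j)^2+y^2) := by
    intro y
    have hre := sl_re δ y
    have him := sl_im δ y
    have n1 : 1/2 ≤ ‖sl δ y‖ := by
      have := abs_re_le_norm (sl δ y); rw [hre, abs_of_pos (by positivity)] at this; linarith
    have n2 : |y| ≤ ‖sl δ y‖ := by
      have := abs_im_le_norm (sl δ y); rwa [him] at this
    have n0 : 0 < ‖sl δ y‖ := by linarith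
    refine kernel_bd (s := ‖sl δ y‖) (x := h) (by positivity) hh0.le J hJx n1 n2 ?_ ?_
    · have := Kf_b1 hx0 hh0 (s := sl δ y) (by rw [hre]; positivity)
      rw [hre] at this
      refine this.trans ?_
      gcongr
    · have := Kf_b2 hx0 hh0 (s := sl δ y) (by rw [hre]; positivity)
      rw [hre] at this
      refine this.trans ?_
      rw [Real.rpow_add (by positivity), Real.rpow_one]
      calc 2 * ((x+h)^(1/2+δ) * (x+h)) / (h * ‖sl δ y‖^2) ≤ 2 * ((8*h) * (2 * h^2)) / (h * ‖sl δ y‖^2) := by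
            gcongr; nlinarith
        _ = _ := by field_simp; ring
  -- integral bound
  have hIntegr : ∫ y, |(G y).re| * ‖K y‖ ≤ 8*(8*h) * ((3 * L) * (C1 * (7 * L))) := by
    have t : ∀ j : ℕ, j ≤ J → ∫ y, |(G y).re| * ((2:ℝ)^j/(((2:ℝ)^j)^2+y^2)) ≤ C1 * (7 * L) := by
      intro j hj
      have h2j : (1:ℝ) ≤ 2^j := one_le_pow₀ (by norm_num)
      refine (hA hχ hp hnz hδ0 hδ1 h2j).2.trans ?_
      have l1 : Real.log N ≤ 2 * L := by
        have : (0:ℝ) < N := by exact_mod_cast Nat.pos_of_ne_zero (NeZero.ne N)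
        have := Real.log_le_log this hN
        rw [Real.log_pow] at this; exact_mod_cast this
      have l2 : Real.log (2 + 2^j) ≤ 4 * L := by
        calc _ ≤ Real.log (3 * 2^j) := Real.log_le_log (by positivity) (by linarith)
          _ = Real.log 3 + j * Real.log 2 := by rw [Real.log_mul (by norm_num) (by positivity), Real.log_pow]
          _ ≤ 2 + J * 1 := by
              have : Real.log 3 ≤ 2 := by have := Real.log_le_sub_one_of_pos (by norm_num : (0:ℝ) < 3); linarith
              have h2 : Real.log 2 ≤ 1 := by linarith [Real.log_two_lt_d9]
              have h3 : (j:ℝ) ≤ J := by exact_mod_cast hj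
              gcongr
          _ ≤ _ := by linarith
      gcongr
      linarith
    have ti : ∀ j : ℕ, Integrable (fun y => |(G y).re| * ((2:ℝ)^j/(((2:ℝ)^j)^2+y^2))) := fun j =>
      (hA hχ hp hnz hδ0 hδ1 (one_le_pow₀ (by norm_num) : (1:ℝ) ≤ 2^j)).1
    calc _ ≤ ∫ y, 8*(8*h) * ∑ j ∈ Finset.range (J+1), |(G y).re| * ((2:ℝ)^j/(((2:ℝ)^j)^2+y^2)) := by
          refine integral_mono_of_nonneg (Filter.Eventually.of_forall fun y => by positivity)
            ((integrable_finset_sum _ fun j _ => ti j).const_mul _) (Filter.Eventually.of_forall fun y => ?_)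
          simp only
          rw [← Finset.mul_sum]
          calc _ ≤ |(G y).re| * (8 * (8*h) * ∑ j ∈ Finset.range (J+1), (2:ℝ)^j/(((2:ℝ)^j)^2+y^2)) := by
                gcongr; exact hKb y
            _ = _ := by ring
      _ = 8*(8*h) * ∑ j ∈ Finset.range (J+1), ∫ y, |(G y).re| * ((2:ℝ)^j/(((2:ℝ)^j)^2+y^2)) := by
          rw [integral_const_mul, integral_finset_sum _ fun j _ => ti j]
      _ ≤ 8*(8*h) * ∑ j ∈ Finset.range (J+1), (C1 * (7 * L)) := by
          gcongr with j hj
          exact t j (by simp at hj; omega)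
      _ = 8*(8*h) * ((J+1) * (C1 * (7 * L))) := by simp
      _ ≤ _ := by gcongr; linarith
  -- combine
  have hcomb : ∫ y, G y * K y = (∫ y, ((2 * (G y).re : ℝ):ℂ) * K y) - (starRingEnd ℂ) (∫ y, G y * (starRingEnd ℂ) (K y)) := by
    rw [← integral_conj]
    have i3 : Integrable (fun y => (starRingEnd ℂ) (G y * (starRingEnd ℂ) (K y))) :=
      (Complex.conjLIE.integrable_comp_iff).2 i2
    have : ∀ y, ((2 * (G y).re : ℝ):ℂ) * K y = G y * K y + (starRingEnd ℂ) (G y * (starRingEnd ℂ) (K y)) := by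
      intro y
      rw [map_mul, conj_conj, ← add_mul, add_conj]
    simp only [this]
    rw [integral_add i1 i3]; ring
  have hn1 : ‖∫ y, ((2 * (G y).re : ℝ):ℂ) * K y‖ ≤ 2 * ∫ y, |(G y).re| * ‖K y‖ := by
    refine (norm_integral_le_integral_norm _).trans (le_of_eq ?_)
    rw [← integral_const_mul]
    congr 1; ext y
    rw [norm_mul, norm_real, Real.norm_eq_abs, abs_mul, abs_two]; ring
  have hfin : 2 * Real.pi * ‖S‖ ≤ 2 * (8*(8*h) * ((3 * L) * (C1 * (7 * L)))) + 2 * Real.pi * (C2/δ^2) := by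
    have e3 : 2 * Real.pi * ‖S‖ = ‖∫ y, G y * K y‖ := by
      rw [e1, norm_neg, norm_mul, norm_mul, Complex.norm_ofNat, norm_real, Real.norm_of_nonneg Real.pi_pos.le]
    rw [e3, hcomb]
    refine (norm_sub_le _ _).trans ?_
    rw [norm_conj]
    refine add_le_add (hn1.trans (by gcongr)) (e2.trans (by gcongr))
  have hδ2 : C2 / δ^2 = C2 * L^2 := by rw [hδ]; field_simp
  rw [hδ2] at hfin
  have hpi := Real.pi_gt_three
  have q1 : C2 * L^2 ≤ C2 * L^2 * h := by
    have : 0 ≤ C2 * L^2 := by positivity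
    nlinarith
  have q2 : 0 ≤ C1 * h * L^2 := by positivity
  have : Real.pi * ‖S‖ ≤ Real.pi * ((C2 + 64 * 21 * C1) * h * L^2) := by
    have q3 := mul_le_mul_of_nonneg_left q1 Real.pi_pos.le
    nlinarith
  exact le_of_mul_le_mul_left this Real.pi_pos

open ArithmeticFunction in
lemma psi_main : ∃ C : ℝ, 0 < C ∧ ∀ {N : ℕ} [NeZero N] {χ : DirichletCharacter ℂ N}, χ ≠ 1 → χ.IsPrimitive →
    (∀ s : ℂ, 1/2 < s.re → χ.LFunction s ≠ 0) → ∀ x : ℝ, 3 ≤ x → (N:ℝ) ≤ x^2 →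
    ‖∑ n ∈ Finset.range (⌊x⌋₊ + 1), χ n * (Λ n : ℂ)‖ ≤ C * Real.sqrt x * (Real.log x)^2 := by
  obtain ⟨C, hC, hm⟩ := smooth_main
  refine ⟨C + 4, by positivity, fun {N} _ {χ} hχ hp hnz x hx hN => ?_⟩
  have hS := hm hχ hp hnz x hx hN
  have hx0 : 0 < x := by linarith
  set h := Real.sqrt x with hh
  have hh1 : 1 ≤ h := by rw [hh]; exact Real.one_le_sqrt.2 (by linarith)
  have hh0 : 0 < h := by linarith
  have hhx : h^2 = x := Real.sq_sqrt hx0.le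
  set L := Real.log x with hL
  have hL1 : 1 ≤ L := by
    rw [hL, Real.le_log_iff_exp_le hx0]; linarith [Real.exp_one_lt_d9]
  have hle : ⌊x⌋₊ + 1 ≤ ⌊x + h⌋₊ + 1 := by gcongr; linarith
  have e1 : ∑' n : ℕ, χ n * (Λ n : ℂ) * (w x h n : ℂ) = ∑ n ∈ Finset.range (⌊x + h⌋₊ + 1), χ n * (Λ n : ℂ) * (w x h n : ℂ) := by
    apply tsum_eq_sum
    intro n hn
    have : ⌊x+h⌋₊ < n := by simp at hn; omega
    rw [w_zero hh0 (Nat.lt_of_floor_lt this).le]; simp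
  have e2 : ∑ n ∈ Finset.range (⌊x + h⌋₊ + 1), χ n * (Λ n : ℂ) * (w x h n : ℂ) =
      ∑ n ∈ Finset.range (⌊x⌋₊ + 1), χ n * (Λ n : ℂ) + ∑ n ∈ Finset.Ico (⌊x⌋₊ + 1) (⌊x + h⌋₊ + 1), χ n * (Λ n : ℂ) * (w x h n : ℂ) := by
    rw [← Finset.sum_range_add_sum_Ico _ hle]
    congr 1
    refine Finset.sum_congr rfl fun n hn => ?_
    have : n ≤ ⌊x⌋₊ := by simp at hn; omega
    rw [w_one hh0 ((Nat.le_floor_iff hx0.le).1 this)]; simp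
  have b : ‖∑ n ∈ Finset.Ico (⌊x⌋₊ + 1) (⌊x + h⌋₊ + 1), χ n * (Λ n : ℂ) * (w x h n : ℂ)‖ ≤ 4 * h * L^2 := by
    refine (norm_sum_le_of_le (f := fun n : ℕ => χ n * (Λ n : ℂ) * (w x h n : ℂ)) (Finset.Ico (⌊x⌋₊ + 1) (⌊x + h⌋₊ + 1)) (n := fun _ => 2 * L) fun n hn => ?_).trans ?_
    · rw [Finset.mem_Ico] at hn
      rw [norm_mul, norm_mul, norm_real, norm_real, Real.norm_of_nonneg vonMangoldt_nonneg, Real.norm_of_nonneg (w_nonneg hh0)]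
      have n0 : (0:ℝ) < n := by exact_mod_cast (by omega : 0 < n)
      have n1 : (n:ℝ) ≤ x^2 := by
        have : (n:ℝ) ≤ x + h := (Nat.le_floor_iff (by positivity)).1 (by omega : n ≤ ⌊x+h⌋₊)
        nlinarith
      have hl : Λ n ≤ 2 * L := by
        refine vonMangoldt_le_log.trans ?_
        have := Real.log_le_log n0 n1
        rw [Real.log_pow] at this; exact_mod_cast this
      calc ‖χ n‖ * Λ n * w x h n ≤ 1 * (2 * L) * 1 := by
            have := w_nonneg (x := x) (h := h) (u := n) hh0
            have h3 : 0 ≤ Λ n := vonMangoldt_nonneg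
            gcongr
            · exact χ.norm_le_one _
            · exact w_le hh0
        _ = _ := by ring
    · rw [Finset.sum_const, Nat.card_Ico, nsmul_eq_mul]
      have : ((⌊x + h⌋₊ + 1 - (⌊x⌋₊ + 1) : ℕ):ℝ) ≤ 2 * h := by
        rw [Nat.cast_sub hle]
        push_cast
        have := Nat.floor_le (by positivity : 0 ≤ x + h)
        have := Nat.lt_floor_add_one x
        linarith
      calc _ ≤ (2 * h) * (2 * L) := by gcongr
        _ ≤ _ := by nlinarith [mul_nonneg hh0.le (by linarith : 0 ≤ L)]
  rw [e1, e2] at hS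
  have := norm_sub_le (∑ n ∈ Finset.range (⌊x⌋₊ + 1), χ n * (Λ n : ℂ) + ∑ n ∈ Finset.Ico (⌊x⌋₊ + 1) (⌊x + h⌋₊ + 1), χ n * (Λ n : ℂ) * (w x h n : ℂ)) (∑ n ∈ Finset.Ico (⌊x⌋₊ + 1) (⌊x + h⌋₊ + 1), χ n * (Λ n : ℂ) * (w x h n : ℂ))
  rw [add_sub_cancel_right] at this
  linarith

end S17
end

section
open Complex MeasureTheory Set

namespace S17

lemma abel_bd (a : ℕ → ℂ) (b : ℕ → ℝ) (B : ℝ) (n : ℕ) (hA : ∀ k ≤ n, ‖∑ i ∈ Finset.range k, a i‖ ≤ B)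
    (hb : ∀ i, b (i+1) ≤ b i) (hb0 : ∀ i, 0 ≤ b i) :
    ‖∑ i ∈ Finset.range n, a i * (b i : ℂ)‖ ≤ B * b 0 := by
  have hB : 0 ≤ B := (norm_nonneg _).trans (hA 0 (Nat.zero_le _))
  have id : ∀ m : ℕ, ∑ i ∈ Finset.range m, a i * (b i : ℂ) =
      (∑ i ∈ Finset.range m, a i) * (b m : ℂ) + ∑ i ∈ Finset.range m, (∑ j ∈ Finset.range (i+1), a j) * ((b i - b (i+1) : ℝ) : ℂ) := by
    intro m
    induction m with
    | zero => simp
    | succ m ih =>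
      rw [Finset.sum_range_succ, ih, Finset.sum_range_succ (f := fun i => (∑ j ∈ Finset.range (i+1), a j) * ((b i - b (i+1) : ℝ) : ℂ)), Finset.sum_range_succ (f := a)]
      push_cast; ring
  rw [id]
  refine (norm_add_le _ _).trans ?_
  have h1 : ‖(∑ i ∈ Finset.range n, a i) * (b n : ℂ)‖ ≤ B * b n := by
    rw [norm_mul, norm_real, Real.norm_of_nonneg (hb0 n)]
    exact mul_le_mul_of_nonneg_right (hA n le_rfl) (hb0 n)
  have h2 : ‖∑ i ∈ Finset.range n, (∑ j ∈ Finset.range (i+1), a j) * ((b i - b (i+1) : ℝ) : ℂ)‖ ≤ ∑ i ∈ Finset.range n, B * (b i - b (i+1)) := by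
    refine norm_sum_le_of_le _ fun i hi => ?_
    rw [Finset.mem_range] at hi
    rw [norm_mul, norm_real, Real.norm_of_nonneg (by linarith [hb i])]
    exact mul_le_mul_of_nonneg_right (hA (i+1) (by omega)) (by linarith [hb i])
  rw [← Finset.mul_sum, Finset.sum_range_sub'] at h2
  linarith

open ArithmeticFunction in
lemma theta_main : ∃ C : ℝ, 0 < C ∧ ∀ {N : ℕ} [NeZero N] {χ : DirichletCharacter ℂ N}, χ ≠ 1 → χ.IsPrimitive →
    (∀ s : ℂ, 1/2 < s.re → χ.LFunction s ≠ 0) → ∀ n : ℕ, 3 ≤ n → N ≤ n^2 →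
    ‖∑ i ∈ Finset.range (n + 1), (if i.Prime then χ i * (Real.log i : ℂ) else 0)‖ ≤ C * Real.sqrt n * (Real.log n)^2 := by
  obtain ⟨C, hC, hm⟩ := psi_main
  refine ⟨C + 2, by positivity, fun {N} _ {χ} hχ hp hnz n hn hN => ?_⟩
  have hn3 : (3:ℝ) ≤ n := by exact_mod_cast hn
  have h1 := hm hχ hp hnz n hn3 (by exact_mod_cast hN)
  rw [Nat.floor_natCast] at h1
  have h2 := Chebyshev.psi_sub_theta_le (x := (n:ℝ)) (by linarith)
  rw [Chebyshev.psi_sub_theta_eq_sum_not_prime, Nat.floor_natCast] at h2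
  have hL1 : 1 ≤ Real.log n := by
    rw [Real.le_log_iff_exp_le (by linarith)]; linarith [Real.exp_one_lt_d9]
  have h3 : ‖∑ i ∈ Finset.range (n+1), (χ i * (Λ i : ℂ) - (if i.Prime then χ i * (Real.log i : ℂ) else 0))‖ ≤
      ∑ i ∈ Finset.Ioc 0 n with ¬ i.Prime, Λ i := by
    rw [Finset.sum_filter]
    have : ∑ i ∈ Finset.Ioc 0 n, (if ¬ i.Prime then Λ i else 0) = ∑ i ∈ Finset.range (n+1), (if ¬ i.Prime then Λ i else 0) := by
      apply Finset.sum_subset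
      · intro i; simp
      · intro i hi hi2
        have : i = 0 := by simp at hi hi2; omega
        simp [this]
    rw [this]
    refine norm_sum_le_of_le _ fun i hi => ?_
    by_cases hpi : i.Prime
    · simp [hpi, vonMangoldt_apply_prime hpi]
    · simp only [hpi, if_false, sub_zero, not_false_eq_true, if_true]
      rw [norm_mul, norm_real, Real.norm_of_nonneg vonMangoldt_nonneg]
      have h3 : 0 ≤ Λ i := vonMangoldt_nonneg
      calc _ ≤ 1 * Λ i := by gcongr; exact χ.norm_le_one _
        _ = _ := one_mul _
  rw [Finset.sum_sub_distrib] at h3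
  have h4 := norm_sub_le (∑ i ∈ Finset.range (n+1), χ i * (Λ i : ℂ)) (∑ i ∈ Finset.range (n+1), χ i * (Λ i : ℂ) - ∑ i ∈ Finset.range (n+1), (if i.Prime then χ i * (Real.log i : ℂ) else 0))
  rw [sub_sub_cancel] at h4
  have h5 : 2 * Real.sqrt n * Real.log n ≤ 2 * Real.sqrt n * Real.log n ^2 := by
    gcongr; nlinarith
  linarith

lemma card_primes_le (n : ℕ) {N : ℕ} (χ : DirichletCharacter ℂ N) :
    ‖∑ i ∈ Finset.range (n+1), (if i.Prime then χ i else 0)‖ ≤ n + 1 := by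
  refine (norm_sum_le_of_le (n := fun _ => (1:ℝ)) _ fun i hi => ?_).trans ?_
  · split_ifs
    · exact χ.norm_le_one _
    · simp
  · simp

lemma prime_main : ∃ C : ℝ, 0 < C ∧ ∀ {N : ℕ} [NeZero N] {χ : DirichletCharacter ℂ N}, χ ≠ 1 → χ.IsPrimitive →
    (∀ s : ℂ, 1/2 < s.re → χ.LFunction s ≠ 0) → ∀ x : ℝ, 9 ≤ x → (N:ℝ) ≤ x →
    ‖∑ i ∈ Finset.range (⌊x⌋₊ + 1), (if i.Prime then χ i else 0)‖ ≤ C * Real.sqrt x * Real.log x := by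
  obtain ⟨C, hC, hm⟩ := theta_main
  refine ⟨4 * C + 3, by positivity, fun {N} _ {χ} hχ hp hnz x hx hN => ?_⟩
  have hx0 : 0 < x := by linarith
  set h := Real.sqrt x with hh
  have hhx : h^2 = x := Real.sq_sqrt hx0.le
  have hh3 : 3 ≤ h := by rw [hh]; exact Real.le_sqrt_of_sq_le (by linarith)
  set L := Real.log x with hL
  have hL1 : 1 ≤ L := by
    rw [hL, Real.le_log_iff_exp_le hx0]; linarith [Real.exp_one_lt_d9]
  set m := ⌈h⌉₊ with hmdef
  set M := ⌊x⌋₊ with hM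
  have hm1 : h ≤ m := Nat.le_ceil _
  have hm2 : (m:ℝ) < h + 1 := Nat.ceil_lt_add_one (by linarith)
  have hmM : m ≤ M := by rw [hM, Nat.le_floor_iff hx0.le]; nlinarith
  have hMx : (M:ℝ) ≤ x := Nat.floor_le hx0.le
  have hm3 : 3 ≤ m := by exact_mod_cast hh3.trans hm1
  set A := fun i : ℕ => (if i.Prime then χ i * (Real.log i : ℂ) else 0) with hAdef
  have hT : ∀ n : ℕ, m ≤ n → n ≤ M → ‖∑ i ∈ Finset.range (n+1), A i‖ ≤ C * h * L^2 := by
    intro n h1 h2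
    have hn0 : (0:ℝ) < n := by exact_mod_cast (by omega : 0 < n)
    have hmn : (m:ℝ) ≤ n := by exact_mod_cast h1
    have hnM : (n:ℝ) ≤ x := le_trans (by exact_mod_cast h2) hMx
    have hn1 : (1:ℝ) ≤ n := by linarith
    refine (hm hχ hp hnz n (by omega) ?_).trans ?_
    · have : (N:ℝ) ≤ (n:ℝ)^2 := by nlinarith
      exact_mod_cast this
    · have := Real.log_nonneg hn1
      rw [hh, hL]
      gcongr
  have hsplit : ∑ i ∈ Finset.range (M + 1), (if i.Prime then χ i else 0) = ∑ i ∈ Finset.range (m+1), (if i.Prime then χ i else 0)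
      + ∑ i ∈ Finset.range (M - m), A (m + 1 + i) * (((Real.log ((m + 1 + i : ℕ):ℝ))⁻¹ : ℝ) : ℂ) := by
    rw [← Finset.sum_range_add_sum_Ico _ (by omega : m + 1 ≤ M + 1), Finset.sum_Ico_eq_sum_range]
    congr 1
    rw [(by omega : M + 1 - (m + 1) = M - m)]
    refine Finset.sum_congr rfl fun i hi => ?_
    simp only [hAdef]
    split_ifs with hpi
    · have h2 : (1:ℝ) < ((m + 1 + i : ℕ):ℝ) := by exact_mod_cast hpi.one_lt
      have : ((Real.log ((m + 1 + i : ℕ):ℝ) : ℝ) : ℂ) ≠ 0 := by exact_mod_cast (Real.log_pos h2).ne'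
      rw [ofReal_inv, mul_assoc, mul_inv_cancel₀ this, mul_one]
    · simp
  have hAb := abel_bd (fun i => A (m + 1 + i)) (fun i => (Real.log ((m + 1 + i : ℕ):ℝ))⁻¹) (2 * (C * h * L^2)) (M - m) ?_ ?_ ?_
  · rw [hsplit]
    refine (norm_add_le _ _).trans ?_
    have c1 := card_primes_le m χ
    have c2 : (Real.log ((m + 1 + 0 : ℕ):ℝ))⁻¹ ≤ 2 / L := by
      have : L / 2 ≤ Real.log ((m + 1 + 0 : ℕ):ℝ) := by
        rw [hL, ← Real.log_sqrt hx0.le, ← hh]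
        apply Real.log_le_log (by linarith)
        push_cast; linarith
      rw [show 2 / L = (L/2)⁻¹ by rw [inv_div]]
      apply inv_anti₀ (by linarith) this
    have c3 : 2 * (C * h * L^2) * (Real.log ((m + 1 + 0 : ℕ):ℝ))⁻¹ ≤ 4 * C * h * L := by
      calc _ ≤ 2 * (C * h * L^2) * (2 / L) := by gcongr
        _ = _ := by field_simp; ring
    have c4 : h ≤ h * L := by nlinarith
    have := hAb.trans c3
    nlinarith
  · intro k hk
    have e : ∑ i ∈ Finset.range k, A (m + 1 + i) = ∑ i ∈ Finset.range (m + k + 1), A i - ∑ i ∈ Finset.range (m+1), A i := by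
      rw [← Finset.sum_range_add_sum_Ico _ (by omega : m + 1 ≤ m + k + 1), add_sub_cancel_left, Finset.sum_Ico_eq_sum_range]
      rw [(by omega : m + k + 1 - (m + 1) = k)]
    rw [e]
    refine (norm_sub_le _ _).trans ?_
    have := hT (m+k) (by omega) (by omega)
    have := hT m le_rfl hmM
    linarith
  · intro i
    apply inv_anti₀
    · apply Real.log_pos; exact_mod_cast (by omega : 1 < m + 1 + i)
    · apply Real.log_le_log
      · exact_mod_cast (by omega : 0 < m + 1 + i)
      · exact_mod_cast (by omega : m + 1 + i ≤ m + 1 + (i+1))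
  · intro i
    exact inv_nonneg.2 (Real.log_natCast_nonneg _)

lemma card_pf {d : ℕ} (hd : d ≠ 0) : (d.primeFactors.card : ℝ) ≤ 2 * Real.log d := by
  have h1 : 2^d.primeFactors.card ≤ ∏ p ∈ d.primeFactors, p :=
    Finset.pow_card_le_prod _ _ _ fun p hp => (Nat.prime_of_mem_primeFactors hp).two_le
  have h2 : ∏ p ∈ d.primeFactors, p ≤ d := Nat.le_of_dvd (Nat.pos_of_ne_zero hd) (Nat.prod_primeFactors_dvd d)
  have h3 : (2:ℝ)^d.primeFactors.card ≤ d := by exact_mod_cast h1.trans h2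
  have h4 := Real.log_le_log (by positivity) h3
  rw [Real.log_pow] at h4
  have : (0:ℝ) ≤ d.primeFactors.card := by positivity
  nlinarith [Real.log_two_gt_d9]

lemma prim_diff {d : ℕ} [NeZero d] (χ : DirichletCharacter ℂ d) (n : ℕ) :
    ‖∑ i ∈ Finset.range (n+1), (if i.Prime then χ i else 0) -
      ∑ i ∈ Finset.range (n+1), (if i.Prime then χ.primitiveCharacter i else 0)‖ ≤ 2 * Real.log d := by
  refine le_trans ?_ (card_pf (NeZero.ne d))
  rw [← Finset.sum_sub_distrib]
  have : (d.primeFactors.card : ℝ) = ∑ i ∈ d.primeFactors, (1:ℝ) := by simp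
  rw [this]
  calc _ ≤ ∑ i ∈ Finset.range (n+1), (if i ∈ d.primeFactors then (1:ℝ) else 0) := by
        refine norm_sum_le_of_le _ fun i hi => ?_
        by_cases hp : i.Prime
        · simp only [hp, if_true]
          by_cases hd : i ∣ d
          · have : χ i = 0 := by
              apply χ.map_nonunit
              rw [ZMod.isUnit_iff_coprime, hp.coprime_iff_not_dvd]; simpa using hd
            rw [this, if_pos (by simp [hp, hd, NeZero.ne d]), zero_sub, norm_neg]
            exact DirichletCharacter.norm_le_one _ _
          · have hc : IsCoprime (i:ℤ) (d:ℤ) := Nat.isCoprime_iff_coprime.2 ((hp.coprime_iff_not_dvd).2 hd)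
            have := χ.primitiveCharacter_apply_of_isCoprime hc
            simp only [Int.cast_natCast] at this
            rw [this]
            simp; split_ifs <;> norm_num
        · simp only [hp, if_false, sub_zero, norm_zero]
          split_ifs <;> norm_num
    _ = ∑ i ∈ (Finset.range (n+1)).filter (· ∈ d.primeFactors), (1:ℝ) := by rw [Finset.sum_filter]
    _ ≤ _ := by
        apply Finset.sum_le_sum_of_subset_of_nonneg
        · intro i hi; exact (Finset.mem_filter.1 hi).2
        · intros; norm_num

lemma final (hG : ∀ (d : ℕ) [NeZero d] (χ : DirichletCharacter ℂ d) (s : ℂ), χ ≠ 1 → χ.LFunction s = 0 → 0 < s.re → s.re < 1 → s.re = 1/2) :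
    ∃ K > (0:ℝ), ∀ x : ℝ, 2 ≤ x → ∀ (d : ℕ) (χ : DirichletCharacter ℂ d),
      χ ≠ 1 → (d : ℝ) ≤ x →
      ‖∑ p ∈ (Finset.range (Nat.floor x + 1)).filter Nat.Prime, χ p‖ ≤
        K * Real.sqrt x * Real.log x := by
  obtain ⟨C, hC, hm⟩ := prime_main
  refine ⟨C + 20, by positivity, fun x hx d χ hχ hd => ?_⟩
  rw [Finset.sum_filter]
  have hx0 : 0 < x := by linarith
  have hs1 : 1 ≤ Real.sqrt x := Real.one_le_sqrt.2 (by linarith)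
  have hl2 : Real.log 2 ≤ Real.log x := Real.log_le_log (by norm_num) hx
  have hl : 1/2 ≤ Real.log x := by linarith [Real.log_two_gt_d9]
  have hsl : 1/2 ≤ Real.sqrt x * Real.log x := by nlinarith
  rcases Nat.eq_zero_or_pos d with rfl | hdpos
  · have : ∀ i ∈ Finset.range (Nat.floor x + 1), (if i.Prime then χ i else 0) = 0 := by
      intro i hi
      split_ifs with hp
      · apply χ.map_nonunit
        rw [ZMod.isUnit_iff_coprime, Nat.coprime_zero_right]; exact hp.one_lt.ne'
      · rfl
    rw [Finset.sum_eq_zero this, norm_zero]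
    positivity
  haveI : NeZero d := ⟨hdpos.ne'⟩
  rcases lt_or_ge x 9 with h9 | h9
  · refine (card_primes_le _ χ).trans ?_
    have := Nat.floor_le hx0.le
    rw [mul_assoc]
    nlinarith [mul_nonneg hC.le (by linarith : 0 ≤ Real.sqrt x * Real.log x)]
  haveI : NeZero χ.conductor := ⟨χ.conductor_ne_zero⟩
  have hχ0 : χ.primitiveCharacter ≠ 1 := by
    intro h
    have := χ.changeLevel_primitiveCharacter
    rw [h, DirichletCharacter.changeLevel_one] at this
    exact hχ this.symm
  have hnz : ∀ s : ℂ, 1/2 < s.re → χ.primitiveCharacter.LFunction s ≠ 0 := by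
    intro s hs h0
    rcases lt_or_ge s.re 1 with h1 | h1
    · have := hG _ _ s hχ0 h0 (by linarith) h1
      linarith
    · exact χ.primitiveCharacter.LFunction_ne_zero_of_one_le_re (Or.inl hχ0) h1 h0
  have hcd : χ.conductor ≤ d := Nat.le_of_dvd hdpos χ.conductor_dvd_level
  have h1 := hm hχ0 χ.primitiveCharacter_isPrimitive hnz x h9 (le_trans (by exact_mod_cast hcd) hd)
  have h2 := prim_diff χ ⌊x⌋₊
  have h3 : Real.log d ≤ Real.log x := Real.log_le_log (by exact_mod_cast hdpos) hd
  have h4 := norm_sub_norm_le (∑ i ∈ Finset.range (⌊x⌋₊+1), (if i.Prime then χ i else 0)) (∑ i ∈ Finset.range (⌊x⌋₊+1), (if i.Prime then χ.primitiveCharacter i else 0))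
  have h5 : Real.log x ≤ Real.sqrt x * Real.log x := by nlinarith
  nlinarith

end S17
end

/-- assuming GRH, for every non-principal Dirichlet character `χ` of
modulus `d ≤ x` one has `Σ_{p ≤ x} χ(p) ≪ x^{1/2} log x` with an absolute implied
constant. -/
theorem statement_17 (hGRH : GRH) :
    ∃ K > (0:ℝ), ∀ x : ℝ, 2 ≤ x → ∀ (d : ℕ) (χ : DirichletCharacter ℂ d),
      χ ≠ 1 → (d : ℝ) ≤ x →
      ‖∑ p ∈ (Finset.range (Nat.floor x + 1)).filter Nat.Prime, χ p‖ ≤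
        K * Real.sqrt x * Real.log x := by
  refine S17.final fun d hd χ s _ h0 h1 h2 => ?_
  refine hGRH d hd.out χ s ?_ h1 h2
  unfold LFun
  rw [dif_pos hd.out]
  exact h0
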